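/- There exist constants C > 0 and c > 0 such that the following holds for every constant ε > 0 and all sufficiently large n. Let a, b ≥ 1 with d := a + b satisfying 5·log n < d < n^{1/3 − ε}, and let G be drawn from the stochastic block model G_{2n, a/n, b/n} with adjacency matrix A, degree matrix D, normalized adjacency matrix N = D^{−1/2} A D^{−1/2}, and expectation matrix B = E[A]. Then with probability at least 1 − n^{−c}, all degrees are positive and ‖d·N − B‖ ≤ C·sqrt(d). -/

import Mathlib

open MeasureTheory

/-- The Bernoulli measure on `Bool` with parameter `p`. -/
noncomputable def bern (p : ℝ) : Measure Bool :=
  p.toNNReal • Measure.dirac true + (1 - p).toNNReal • Measure.dirac false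

/-- The stochastic block model `G_{2n,p,q}`: a symmetric random graph on `2n` vertices,
encoded by independent Bernoulli edge indicators `ω i j` (only the coordinates with
`i ≤ j` are used by `adjOf`), where the pair `{i,j}` (self-loop pairs included) is an
edge with probability `p` if `i,j` are in the same community (`V₁ = {i | i < n}`,
`V₂ = {i | n ≤ i}`) and with probability `q` otherwise. -/
noncomputable def sbm (n : ℕ) (p q : ℝ) :
    Measure (Fin (2 * n) → Fin (2 * n) → Bool) :=
  Measure.pi fun i => Measure.pi fun j =>
    bern (if i.val < n ↔ j.val < n then p else q)

/-- The (symmetric, 0/1) adjacency matrix determined by the edge indicators `ω`. -/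
noncomputable def adjOf {m : ℕ} (ω : Fin m → Fin m → Bool) : Matrix (Fin m) (Fin m) ℝ :=
  Matrix.of fun i j => if i ≤ j then (if ω i j then 1 else 0) else (if ω j i then 1 else 0)

/-- The degree of vertex `i`. -/
noncomputable def deg {m : ℕ} (ω : Fin m → Fin m → Bool) (i : Fin m) : ℝ :=
  ∑ j, adjOf ω i j

/-- The spectral norm (ℓ²-operator norm) of a square real matrix. -/
noncomputable def specNorm {m : ℕ} (M : Matrix (Fin m) (Fin m) ℝ) : ℝ :=
  ‖Matrix.toEuclideanCLM (𝕜 := ℝ) M‖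

/-- The expectation matrix `B = 𝔼[A]`: entries `a/n` within communities, `b/n` across. -/
noncomputable def Bmat (n : ℕ) (a b : ℝ) : Matrix (Fin (2*n)) (Fin (2*n)) ℝ :=
  Matrix.of fun i j => if i.val < n ↔ j.val < n then a / n else b / n

/-- The partition indicator vector `χ`: `+1` on the first community, `-1` on the second. -/
noncomputable def chi (n : ℕ) (i : Fin (2*n)) : ℝ := if i.val < n then 1 else -1

/-- The normalized adjacency matrix `N = D^{-1/2} A D^{-1/2}`. -/
noncomputable def normAdj {m : ℕ} (ω : Fin m → Fin m → Bool) : Matrix (Fin m) (Fin m) ℝ :=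
  Matrix.diagonal (fun i => (Real.sqrt (deg ω i))⁻¹) * adjOf ω *
    Matrix.diagonal (fun i => (Real.sqrt (deg ω i))⁻¹)

/-- The real number `1` or `0` recording whether an edge indicator is on. -/
noncomputable def edgeVal (b : Bool) : ℝ := if b then 1 else 0

/-- Independent Bernoulli edge indicators with success probabilities `P i j`. -/
noncomputable def bernPi {m : ℕ} (P : Fin m → Fin m → ℝ) : Measure (Fin m → Fin m → Bool) :=
  Measure.pi fun i => Measure.pi fun j => bern (P i j)

lemma edgeVal_nonneg (b : Bool) : 0 ≤ edgeVal b := by unfold edgeVal; split_ifs <;> norm_num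

lemma bern_isProbabilityMeasure {p : ℝ} (h0 : 0 ≤ p) (h1 : p ≤ 1) :
    IsProbabilityMeasure (bern p) := by
  constructor
  simp only [bern, Measure.add_apply, Measure.smul_apply, measure_univ]
  rw [ENNReal.smul_def, ENNReal.smul_def]
  simp only [smul_eq_mul, mul_one]
  rw [← ENNReal.coe_add, ← Real.toNNReal_add h0 (by linarith)]
  simp

lemma integral_bern {p : ℝ} (h0 : 0 ≤ p) (h1 : p ≤ 1) (f : Bool → ℝ) :
    ∫ x, f x ∂(bern p) = p * f true + (1 - p) * f false := by
  rw [bern, integral_add_measure (Integrable.of_finite) (Integrable.of_finite),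
    integral_smul_nnreal_measure, integral_smul_nnreal_measure]
  simp [NNReal.smul_def, h0, h1]

lemma bernPi_isProbabilityMeasure {m : ℕ} {P : Fin m → Fin m → ℝ}
    (h0 : ∀ i j, 0 ≤ P i j) (h1 : ∀ i j, P i j ≤ 1) : IsProbabilityMeasure (bernPi P) := by
  have := fun i j => bern_isProbabilityMeasure (h0 i j) (h1 i j)
  unfold bernPi
  infer_instance

lemma integral_exp_bernPi {m : ℕ} {P : Fin m → Fin m → ℝ}
    (h0 : ∀ i j, 0 ≤ P i j) (h1 : ∀ i j, P i j ≤ 1) (θ : Fin m → Fin m → ℝ) :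
    ∫ ω, Real.exp (∑ i, ∑ j, θ i j * edgeVal (ω i j)) ∂(bernPi P) =
      ∏ i, ∏ j, (1 + P i j * (Real.exp (θ i j) - 1)) := by
  have := fun i j => bern_isProbabilityMeasure (h0 i j) (h1 i j)
  simp only [Real.exp_sum, bernPi]
  rw [integral_fintype_prod_eq_prod (𝕜 := ℝ)
    (f := fun i (x : Fin m → Bool) => ∏ j, Real.exp (θ i j * edgeVal (x j)))]
  refine Finset.prod_congr rfl fun i _ => ?_
  rw [integral_fintype_prod_eq_prod (𝕜 := ℝ)
    (f := fun j (x : Bool) => Real.exp (θ i j * edgeVal x))]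
  refine Finset.prod_congr rfl fun j _ => ?_
  rw [integral_bern (h0 i j) (h1 i j)]
  simp [edgeVal]
  ring

/-- Chernoff's bound for weighted sums of independent edge indicators. -/
lemma bernPi_chernoff {m : ℕ} {P : Fin m → Fin m → ℝ}
    (h0 : ∀ i j, 0 ≤ P i j) (h1 : ∀ i j, P i j ≤ 1) (θ : Fin m → Fin m → ℝ) (t : ℝ) :
    (bernPi P).real {ω | t ≤ ∑ i, ∑ j, θ i j * edgeVal (ω i j)} ≤
      Real.exp (∑ i, ∑ j, P i j * (Real.exp (θ i j) - 1) - t) := by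
  have := bernPi_isProbabilityMeasure h0 h1
  have hm := mul_meas_ge_le_integral_of_nonneg (μ := bernPi P)
    (f := fun ω => Real.exp (∑ i, ∑ j, θ i j * edgeVal (ω i j)))
    (Filter.Eventually.of_forall fun ω => (Real.exp_pos _).le) Integrable.of_finite (Real.exp t)
  rw [integral_exp_bernPi h0 h1] at hm
  simp only [Real.exp_le_exp] at hm
  have hp : ∏ i, ∏ j, (1 + P i j * (Real.exp (θ i j) - 1)) ≤
      Real.exp (∑ i, ∑ j, P i j * (Real.exp (θ i j) - 1)) := by
    simp only [Real.exp_sum]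
    have hnn : ∀ i j, 0 ≤ 1 + P i j * (Real.exp (θ i j) - 1) := fun i j => by
      nlinarith [h0 i j, h1 i j, mul_nonneg (h0 i j) (Real.exp_pos (θ i j)).le]
    refine Finset.prod_le_prod (fun i _ => Finset.prod_nonneg fun j _ => hnn i j) fun i _ => ?_
    refine Finset.prod_le_prod (fun j _ => hnn i j) fun j _ => ?_
    linarith [Real.add_one_le_exp (P i j * (Real.exp (θ i j) - 1))]
  rw [Real.exp_sub, le_div_iff₀ (Real.exp_pos t), mul_comm]
  exact hm.trans hp

/-- Chernoff's bound, in both directions, for the number of edges in a set of pairs. -/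
lemma bernPi_chernoff_finset {m : ℕ} {P : Fin m → Fin m → ℝ}
    (h0 : ∀ i j, 0 ≤ P i j) (h1 : ∀ i j, P i j ≤ 1) (F : Finset (Fin m × Fin m)) (θ t : ℝ) :
    (bernPi P).real {ω | θ * t ≤ θ * ∑ e ∈ F, edgeVal (ω e.1 e.2)} ≤
      Real.exp ((∑ e ∈ F, P e.1 e.2) * (Real.exp θ - 1) - θ * t) := by
  classical
  have key : ∀ g : Fin m → Fin m → ℝ → ℝ, (∀ i j, g i j 0 = 0) →
      ∑ i, ∑ j, g i j (if (i, j) ∈ F then θ else 0) = ∑ e ∈ F, g e.1 e.2 θ := by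
    intro g hg
    rw [← Fintype.sum_prod_type' (f := fun i j => g i j (if (i, j) ∈ F then θ else 0)),
      ← Finset.sum_filter_add_sum_filter_not Finset.univ (fun e => e ∈ F)]
    rw [Finset.sum_eq_zero (s := Finset.univ.filter fun e => e ∉ F), add_zero]
    · simp only [Finset.filter_univ_mem]
      exact Finset.sum_congr rfl fun e he => by simp [he]
    · intro e he
      simp only [Finset.mem_filter, Finset.mem_univ, true_and] at he
      simp [he, hg]
  have h := bernPi_chernoff h0 h1 (fun i j => if (i, j) ∈ F then θ else 0) (θ * t)
  have e1 := key (fun i j x => P i j * (Real.exp x - 1)) (by simp)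
  have e2 := fun ω : Fin m → Fin m → Bool => key (fun i j x => x * edgeVal (ω i j)) (by simp)
  simpa only [e1, e2, ← Finset.mul_sum, ← Finset.sum_mul] using h

/-- The entropy-type bound `s log (e m / s)` for the logarithm of `m.choose s`. -/
noncomputable def choiceCost (m s : ℝ) : ℝ := s * (1 + Real.log (m / s))

lemma choose_le_exp_choiceCost {m s : ℕ} (hs : 1 ≤ s) (hm : s ≤ m) :
    (m.choose s : ℝ) ≤ Real.exp (choiceCost m s) := by
  have hs' : (0 : ℝ) < s := by exact_mod_cast hs
  have hm' : (0 : ℝ) < m := by exact_mod_cast (by omega : 0 < m)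
  have h1 : (m.choose s : ℝ) ≤ (m : ℝ) ^ s / s.factorial := Nat.choose_le_pow_div s m
  have h2 := Real.pow_div_factorial_le_exp (x := (s : ℝ)) hs'.le s
  have h3 : Real.exp (choiceCost m s) = Real.exp s * ((m : ℝ) / s) ^ s := by
    rw [choiceCost, mul_add, mul_one, Real.exp_add, ← Real.log_pow,
      Real.exp_log (by positivity)]
  rw [h3]
  refine h1.trans ?_
  calc (m : ℝ) ^ s / s.factorial = (s : ℝ) ^ s / s.factorial * ((m : ℝ) / s) ^ s := by
        rw [div_pow]; field_simp
    _ ≤ _ := by gcongr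

lemma one_add_log_le_choiceCost {m s : ℕ} (hs : 1 ≤ s) (hm : s ≤ m) :
    1 + Real.log m ≤ choiceCost m s := by
  have hs' : (1 : ℝ) ≤ s := by exact_mod_cast hs
  have hm' : (s : ℝ) ≤ m := by exact_mod_cast hm
  have h1 := Real.log_le_sub_one_of_pos (x := (s : ℝ)) (by linarith)
  have h2 : 0 ≤ Real.log ((m : ℝ) / s) := Real.log_nonneg (by rw [le_div_iff₀] <;> linarith)
  have h3 : Real.log ((m : ℝ) / s) = Real.log m - Real.log s :=
    Real.log_div (by linarith) (by linarith)
  unfold choiceCost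
  nlinarith

lemma sum_exp_neg_choiceCost_le {m : ℕ} (hm : 1 ≤ m) :
    ∑ S : Finset (Fin m), (if S.card = 0 then 0 else
      Real.exp (-(3 * choiceCost m S.card))) ≤ 1 / m := by
  have hm' : (0 : ℝ) < m := by exact_mod_cast hm
  have h := Finset.sum_powerset_apply_card (fun s : ℕ => if s = 0 then (0 : ℝ) else
      Real.exp (-(3 * choiceCost m s))) (x := (Finset.univ : Finset (Fin m)))
  rw [Finset.powerset_univ] at h
  rw [h, Finset.card_univ, Fintype.card_fin, Finset.sum_range_succ']
  simp only [Nat.add_eq_zero_iff, one_ne_zero, and_false, if_false, if_true, smul_zero, add_zero,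
    nsmul_eq_mul]
  have hb : ∀ k ∈ Finset.range m, (m.choose (k + 1) : ℝ) *
      Real.exp (-(3 * choiceCost m (k + 1 : ℕ))) ≤ 1 / (m : ℝ) ^ 2 := by
    intro k hk
    have hk' : k + 1 ≤ m := by simpa using hk
    have c1 := choose_le_exp_choiceCost (Nat.le_add_left 1 k) hk'
    have c2 := one_add_log_le_choiceCost (Nat.le_add_left 1 k) hk'
    calc _ ≤ Real.exp (choiceCost m (k + 1 : ℕ)) * Real.exp (-(3 * choiceCost m (k + 1 : ℕ))) := by
          gcongr
      _ = Real.exp (-(2 * choiceCost m (k + 1 : ℕ))) := by rw [← Real.exp_add]; ring_nf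
      _ ≤ Real.exp (-(2 * Real.log m)) := by
          apply Real.exp_le_exp.2; linarith
      _ = 1 / (m : ℝ) ^ 2 := by
          rw [Real.exp_neg, mul_comm, Real.exp_mul, Real.exp_log hm']; simp
  refine (Finset.sum_le_sum hb).trans ?_
  rw [Finset.sum_const, Finset.card_range, nsmul_eq_mul]
  apply le_of_eq; field_simp

/-- The number of edges between two sets, counted through the indicators `ω i j`. -/
noncomputable def edgeCount {m : ℕ} (ω : Fin m → Fin m → Bool) (S T : Finset (Fin m)) : ℝ :=
  ∑ i ∈ S, ∑ j ∈ T, edgeVal (ω i j)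

/-- Two sets are joined either by few edges compared with `p |S| |T|`, or by few edges compared
with the entropy of the pair. -/
def Discrepancy {m : ℕ} (p : ℝ) (ω : Fin m → Fin m → Bool) : Prop :=
  ∀ S T : Finset (Fin m), S.Nonempty → T.Nonempty →
    edgeCount ω S T ≤ Real.exp 2 * (p * S.card * T.card) ∨
    edgeCount ω S T * Real.log (edgeCount ω S T / (p * S.card * T.card)) ≤
      6 * (choiceCost m S.card + choiceCost m T.card)

lemma bernPi_edgeCount_tail {m : ℕ} {P : Fin m → Fin m → ℝ} {p : ℝ} (hp : 0 < p)
    (h0 : ∀ i j, 0 ≤ P i j) (h1 : ∀ i j, P i j ≤ 1) (hP : ∀ i j, P i j ≤ p)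
    {S T : Finset (Fin m)} (hS : S.Nonempty) (hT : T.Nonempty) (H : ℝ) :
    (bernPi P).real {ω | Real.exp 2 * (p * S.card * T.card) < edgeCount ω S T ∧
      6 * H < edgeCount ω S T * Real.log (edgeCount ω S T / (p * S.card * T.card))} ≤
      Real.exp (-(3 * H)) := by
  classical
  have := bernPi_isProbabilityMeasure h0 h1
  set bad := {ω | Real.exp 2 * (p * S.card * T.card) < edgeCount ω S T ∧
      6 * H < edgeCount ω S T * Real.log (edgeCount ω S T / (p * S.card * T.card))} with hbad
  rcases bad.eq_empty_or_nonempty with he | hne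
  · rw [he]; simp [Real.exp_nonneg]
  obtain ⟨ω₀, hω₀, hmin⟩ := Set.exists_min_image bad (fun ω => edgeCount ω S T)
    (Set.toFinite _) hne
  have hs : (0 : ℝ) < S.card := by exact_mod_cast hS.card_pos
  have ht : (0 : ℝ) < T.card := by exact_mod_cast hT.card_pos
  set μ := p * S.card * T.card with hμ
  have hμ0 : 0 < μ := by positivity
  set r := edgeCount ω₀ S T with hr
  set θ := Real.log (r / μ) with hθ
  obtain ⟨hr1, hr2⟩ := hω₀
  have hr0 : 0 < r := lt_trans (by positivity) hr1
  have hθ2 : 2 ≤ θ := by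
    rw [hθ, Real.le_log_iff_exp_le (by positivity), le_div_iff₀ hμ0]
    exact hr1.le
  have hexp : Real.exp θ = r / μ := Real.exp_log (by positivity)
  have hc := bernPi_chernoff_finset h0 h1 (S ×ˢ T) θ r
  simp only [Finset.sum_product] at hc
  have hsub : bad ⊆ {ω | θ * r ≤ θ * ∑ i ∈ S, ∑ j ∈ T, edgeVal (ω i j)} := by
    intro ω hω
    have := hmin ω hω
    exact mul_le_mul_of_nonneg_left this (by linarith)
  refine (measureReal_mono hsub).trans (hc.trans (Real.exp_le_exp.2 ?_))
  have hPs : ∑ i ∈ S, ∑ j ∈ T, P i j ≤ μ := by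
    calc ∑ i ∈ S, ∑ j ∈ T, P i j ≤ ∑ i ∈ S, ∑ j ∈ T, p :=
          Finset.sum_le_sum fun i _ => Finset.sum_le_sum fun j _ => hP i j
      _ = μ := by simp [hμ]; ring
  have : (∑ i ∈ S, ∑ j ∈ T, P i j) * (Real.exp θ - 1) ≤ r := by
    have h2 : 1 ≤ Real.exp θ := Real.one_le_exp (by linarith)
    calc _ ≤ μ * (Real.exp θ - 1) := by gcongr
      _ ≤ μ * Real.exp θ := by gcongr; linarith
      _ = r := by rw [hexp]; field_simp
  nlinarith

lemma bernPi_not_discrepancy {m : ℕ} (hm : 1 ≤ m) {P : Fin m → Fin m → ℝ} {p : ℝ} (hp : 0 < p)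
    (h0 : ∀ i j, 0 ≤ P i j) (h1 : ∀ i j, P i j ≤ 1) (hP : ∀ i j, P i j ≤ p) :
    (bernPi P).real {ω | ¬ Discrepancy p ω} ≤ 1 / m := by
  classical
  have := bernPi_isProbabilityMeasure h0 h1
  have hm' : (1 : ℝ) ≤ m := by exact_mod_cast hm
  let bad : Finset (Fin m) × Finset (Fin m) → Set (Fin m → Fin m → Bool) := fun q =>
    {ω | (q.1.Nonempty ∧ q.2.Nonempty) ∧
      (Real.exp 2 * (p * q.1.card * q.2.card) < edgeCount ω q.1 q.2 ∧
      6 * (choiceCost m q.1.card + choiceCost m q.2.card) <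
        edgeCount ω q.1 q.2 * Real.log (edgeCount ω q.1 q.2 / (p * q.1.card * q.2.card)))}
  have hsub : {ω | ¬ Discrepancy p ω} ⊆ ⋃ q ∈ (Finset.univ : Finset (_ × _)), bad q := by
    intro ω hω
    simp only [Discrepancy, Set.mem_ofPred_eq, not_forall, not_or, not_le] at hω
    obtain ⟨S, T, hS, hT, h⟩ := hω
    simp only [Finset.mem_univ, Set.iUnion_true, Set.mem_iUnion]
    exact ⟨(S, T), ⟨hS, hT⟩, h⟩
  let f : Finset (Fin m) → ℝ := fun S =>
    if S.card = 0 then 0 else Real.exp (-(3 * choiceCost m S.card))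
  have hbd : ∀ q, (bernPi P).real (bad q) ≤ f q.1 * f q.2 := by
    rintro ⟨S, T⟩
    have hf : ∀ S, 0 ≤ f S := fun S => by dsimp only [f]; split_ifs <;> positivity
    by_cases hS : S.Nonempty
    · by_cases hT : T.Nonempty
      · simp only [bad, f, hS, hT, true_and, hS.card_ne_zero, hT.card_ne_zero, if_false]
        rw [← Real.exp_add]
        refine (bernPi_edgeCount_tail hp h0 h1 hP hS hT _).trans (le_of_eq ?_)
        ring_nf
      · simp only [bad, hT, and_false, false_and, Set.ofPred_false, measureReal_empty]
        exact mul_nonneg (hf _) (hf _)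
    · simp only [bad, hS, false_and, Set.ofPred_false, measureReal_empty]
      exact mul_nonneg (hf _) (hf _)
  calc _ ≤ (bernPi P).real (⋃ q ∈ (Finset.univ : Finset (_ × _)), bad q) :=
        measureReal_mono hsub (measure_ne_top _ _)
    _ ≤ ∑ q, (bernPi P).real (bad q) := measureReal_biUnion_finset_le _ _
    _ ≤ ∑ q : Finset (Fin m) × Finset (Fin m), f q.1 * f q.2 :=
        Finset.sum_le_sum fun q _ => hbd q
    _ = (∑ S, f S) * ∑ T, f T := by
        rw [Fintype.sum_prod_type, Finset.sum_mul_sum]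
    _ ≤ (1 / m) * (1 / m) := by
        have := sum_exp_neg_choiceCost_le hm
        have h00 : 0 ≤ ∑ S, f S := Finset.sum_nonneg fun S _ => by
          dsimp only [f]; split_ifs <;> positivity
        exact mul_le_mul this this h00 (by positivity)
    _ ≤ 1 / m := by
        rw [div_mul_div_comm, one_mul]
        apply one_div_le_one_div_of_le <;> nlinarith

/-- The contribution to the centred bilinear form of the pairs with `|z i * w j| ≤ D`. -/
noncomputable def lightSum {m : ℕ} (P s : Fin m → Fin m → ℝ) (D : ℝ) (ω : Fin m → Fin m → Bool)
    (z w : Fin m → ℤ) : ℝ :=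
  ∑ i, ∑ j, if |(z i : ℝ) * w j| ≤ D then s i j * (z i * w j) * (edgeVal (ω i j) - P i j) else 0

lemma bernPi_lightSum_tail {m : ℕ} {P s : Fin m → Fin m → ℝ} {p D : ℝ} (hD : 0 < D)
    (h0 : ∀ i j, 0 ≤ P i j) (h1 : ∀ i j, P i j ≤ 1) (hP : ∀ i j, P i j ≤ p)
    (hs0 : ∀ i j, 0 ≤ s i j) (hs1 : ∀ i j, s i j ≤ 1) (z w : Fin m → ℤ) (t : ℝ) :
    (bernPi P).real {ω | t * D ≤ lightSum P s D ω z w} ≤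
      Real.exp (p / D ^ 2 * (∑ i, (z i : ℝ) ^ 2) * (∑ j, (w j : ℝ) ^ 2) - t) := by
  have := bernPi_isProbabilityMeasure h0 h1
  set θ : Fin m → Fin m → ℝ := fun i j =>
    if |(z i : ℝ) * w j| ≤ D then s i j * (z i * w j) / D else 0 with hθ
  have hls : ∀ ω, lightSum P s D ω z w =
      D * (∑ i, ∑ j, θ i j * edgeVal (ω i j) - ∑ i, ∑ j, P i j * θ i j) := by
    intro ω
    simp only [lightSum, ← Finset.sum_sub_distrib, Finset.mul_sum, hθ]
    refine Finset.sum_congr rfl fun i _ => Finset.sum_congr rfl fun j _ => ?_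
    split_ifs
    · field_simp
    · simp
  have hset : {ω | t * D ≤ lightSum P s D ω z w} =
      {ω | t + ∑ i, ∑ j, P i j * θ i j ≤ ∑ i, ∑ j, θ i j * edgeVal (ω i j)} := by
    ext ω
    rw [Set.mem_ofPred_eq, Set.mem_ofPred_eq, hls, mul_comm t D, mul_le_mul_iff_right₀ hD]
    constructor <;> intro h <;> linarith
  rw [hset]
  refine (bernPi_chernoff h0 h1 θ _).trans (Real.exp_le_exp.2 ?_)
  have hb : ∀ i j, P i j * (Real.exp (θ i j) - 1) - P i j * θ i j ≤
      p / D ^ 2 * ((z i : ℝ) ^ 2 * (w j : ℝ) ^ 2) := by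
    intro i j
    have hp : 0 ≤ p := (h0 i j).trans (hP i j)
    by_cases hl : |(z i : ℝ) * w j| ≤ D
    · have hθ' : θ i j = s i j * (z i * w j / D) := by simp only [hθ, if_pos hl]; ring
      have hq : |(z i : ℝ) * w j / D| ≤ 1 := by
        rw [abs_div, abs_of_pos hD, div_le_one hD]; exact hl
      have hθ1 : |θ i j| ≤ |(z i : ℝ) * w j / D| := by
        rw [hθ', abs_mul, abs_of_nonneg (hs0 i j)]
        exact mul_le_of_le_one_left (abs_nonneg _) (hs1 i j)
      have he := le_of_abs_le (Real.abs_exp_sub_one_sub_id_le (hθ1.trans hq))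
      have hsq : θ i j ^ 2 ≤ (z i * w j / D) ^ 2 := sq_le_sq.2 hθ1
      calc P i j * (Real.exp (θ i j) - 1) - P i j * θ i j
          = P i j * (Real.exp (θ i j) - 1 - θ i j) := by ring
        _ ≤ P i j * (z i * w j / D) ^ 2 := by
            apply mul_le_mul_of_nonneg_left _ (h0 i j); linarith
        _ ≤ p * (z i * w j / D) ^ 2 := by
            apply mul_le_mul_of_nonneg_right (hP i j) (sq_nonneg _)
        _ = _ := by field_simp
    · simp only [hθ, if_neg hl, Real.exp_zero, sub_self, mul_zero]
      positivity
  have : ∑ i, ∑ j, P i j * (Real.exp (θ i j) - 1) - ∑ i, ∑ j, P i j * θ i j ≤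
      p / D ^ 2 * (∑ i, (z i : ℝ) ^ 2) * (∑ j, (w j : ℝ) ^ 2) := by
    rw [mul_assoc, Finset.sum_mul_sum, Finset.mul_sum]
    simp only [← Finset.sum_sub_distrib, Finset.mul_sum]
    exact Finset.sum_le_sum fun i _ => Finset.sum_le_sum fun j _ => hb i j
  linarith

lemma sum_Icc_exp_neg_sq_le (N : ℕ) :
    ∑ k ∈ Finset.Icc (-(N : ℤ)) N, Real.exp (-(k : ℝ) ^ 2) ≤ Real.exp 2 := by
  classical
  have hsub : Finset.Icc (-(N : ℤ)) N ⊆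
      (Finset.range (N + 1)).image (fun k : ℕ => (k : ℤ)) ∪
      (Finset.range (N + 1)).image (fun k : ℕ => -(k : ℤ)) := by
    intro k hk
    simp only [Finset.mem_Icc] at hk
    simp only [Finset.mem_union, Finset.mem_image, Finset.mem_range]
    rcases le_total 0 k with h | h
    · exact Or.inl ⟨k.toNat, by omega, by omega⟩
    · exact Or.inr ⟨(-k).toNat, by omega, by omega⟩
  have hgeo : ∑ k ∈ Finset.range (N + 1), Real.exp (-(k : ℝ) ^ 2) ≤ 2 := by
    refine (Finset.sum_le_sum fun k _ => ?_).trans (sum_geometric_two_le (N + 1))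
    have h1 : (k : ℝ) ≤ (k : ℝ) ^ 2 := by
      exact_mod_cast Nat.le_self_pow (by norm_num) k
    calc Real.exp (-(k : ℝ) ^ 2) ≤ Real.exp (k * (-1)) := Real.exp_le_exp.2 (by linarith)
      _ = (Real.exp (-1)) ^ k := by rw [Real.exp_nat_mul]
      _ ≤ (1 / 2) ^ k := by
          gcongr
          rw [Real.exp_neg, one_div]
          exact inv_anti₀ (by norm_num) (by linarith [Real.add_one_le_exp (1 : ℝ)])
  calc _ ≤ ∑ k ∈ (Finset.range (N + 1)).image (fun k : ℕ => (k : ℤ)) ∪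
      (Finset.range (N + 1)).image (fun k : ℕ => -(k : ℤ)), Real.exp (-(k : ℝ) ^ 2) :=
        Finset.sum_le_sum_of_subset_of_nonneg hsub fun _ _ _ => (Real.exp_pos _).le
    _ ≤ ∑ k ∈ (Finset.range (N + 1)).image (fun k : ℕ => (k : ℤ)), Real.exp (-(k : ℝ) ^ 2) +
        ∑ k ∈ (Finset.range (N + 1)).image (fun k : ℕ => -(k : ℤ)), Real.exp (-(k : ℝ) ^ 2) := by
        rw [← Finset.sum_union_inter]
        exact le_add_of_nonneg_right (Finset.sum_nonneg fun _ _ => (Real.exp_pos _).le)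
    _ ≤ 2 + 2 := by
        rw [Finset.sum_image (by intro a _ b _ h; simpa using h),
          Finset.sum_image (by intro a _ b _ h; simpa using h)]
        simp only [Int.cast_natCast, Int.cast_neg, neg_sq]
        linarith
    _ ≤ Real.exp 2 := by
        have := Real.quadratic_le_exp_of_nonneg (x := 2) (by norm_num)
        linarith

/-- The integer vectors of squared length at most `K m`. -/
noncomputable def gridVectors (m K : ℕ) : Finset (Fin m → ℤ) :=
  (Fintype.piFinset fun _ => Finset.Icc (-((K * m : ℕ) : ℤ)) (K * m : ℕ)).filter
    fun z => ∑ i, (z i) ^ 2 ≤ K * m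

lemma mem_gridVectors {m K : ℕ} {z : Fin m → ℤ} :
    z ∈ gridVectors m K ↔ ∑ i, (z i : ℝ) ^ 2 ≤ K * m := by
  have hcast : (∑ i, (z i : ℝ) ^ 2 ≤ K * m) ↔ ∑ i, (z i) ^ 2 ≤ (K * m : ℤ) := by
    exact_mod_cast Iff.rfl
  rw [hcast]
  simp only [gridVectors, Finset.mem_filter, Fintype.mem_piFinset, Finset.mem_Icc,
    and_iff_right_iff_imp]
  intro h i
  have h1 : (z i) ^ 2 ≤ K * m :=
    (Finset.single_le_sum (fun j _ => sq_nonneg (z j)) (Finset.mem_univ i)).trans h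
  have h2 : |z i| ≤ (z i) ^ 2 := by rw [← sq_abs]; exact Int.le_self_sq _
  push_cast
  exact abs_le.1 (h2.trans h1)

lemma card_gridVectors_le (m K : ℕ) :
    ((gridVectors m K).card : ℝ) ≤ Real.exp ((K + 2) * m) := by
  have h1 : ∀ z ∈ gridVectors m K,
      (1 : ℝ) ≤ Real.exp (K * m) * ∏ i, Real.exp (-(z i : ℝ) ^ 2) := by
    intro z hz
    have := mem_gridVectors.1 hz
    rw [← Real.exp_sum, ← Real.exp_add, Finset.sum_neg_distrib]
    exact Real.one_le_exp (by linarith)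
  calc ((gridVectors m K).card : ℝ) = ∑ z ∈ gridVectors m K, 1 := by simp
    _ ≤ ∑ z ∈ gridVectors m K, Real.exp (K * m) * ∏ i, Real.exp (-(z i : ℝ) ^ 2) :=
        Finset.sum_le_sum h1
    _ ≤ ∑ z ∈ Fintype.piFinset fun _ : Fin m => Finset.Icc (-((K * m : ℕ) : ℤ)) (K * m : ℕ),
          Real.exp (K * m) * ∏ i, Real.exp (-(z i : ℝ) ^ 2) :=
        Finset.sum_le_sum_of_subset_of_nonneg (Finset.filter_subset _ _)
          fun _ _ _ => mul_nonneg (Real.exp_pos _).le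
            (Finset.prod_nonneg fun _ _ => (Real.exp_pos _).le)
    _ = Real.exp (K * m) * (∑ k ∈ Finset.Icc (-((K * m : ℕ) : ℤ)) (K * m : ℕ),
          Real.exp (-(k : ℝ) ^ 2)) ^ m := by
        rw [← Finset.mul_sum, Finset.sum_prod_piFinset _ fun _ (k : ℤ) => Real.exp (-(k : ℝ) ^ 2)]
        simp
    _ ≤ Real.exp (K * m) * Real.exp 2 ^ m := by
        gcongr
        exact sum_Icc_exp_neg_sq_le _
    _ = _ := by rw [← Real.exp_nat_mul, ← Real.exp_add]; ring_nf

/-- All light sums over the grid are of order `m √d`. -/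
def LightBound {m : ℕ} (P s : Fin m → Fin m → ℝ) (D : ℝ) (ω : Fin m → Fin m → Bool) : Prop :=
  ∀ z ∈ gridVectors m 16, ∀ w ∈ gridVectors m 16, lightSum P s D ω z w ≤ 560 * m * D

lemma bernPi_not_lightBound {m : ℕ} {P s : Fin m → Fin m → ℝ} {p D : ℝ} (hD : 0 < D)
    (hpD : p / D ^ 2 * m = 2)
    (h0 : ∀ i j, 0 ≤ P i j) (h1 : ∀ i j, P i j ≤ 1) (hP : ∀ i j, P i j ≤ p) (hp : 0 ≤ p)
    (hs0 : ∀ i j, 0 ≤ s i j) (hs1 : ∀ i j, s i j ≤ 1) :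
    (bernPi P).real {ω | ¬ LightBound P s D ω} ≤ Real.exp (-m) := by
  classical
  have := bernPi_isProbabilityMeasure h0 h1
  have hsub : {ω | ¬ LightBound P s D ω} ⊆ ⋃ q ∈ gridVectors m 16 ×ˢ gridVectors m 16,
      {ω | 560 * m * D ≤ lightSum P s D ω q.1 q.2} := by
    intro ω hω
    simp only [LightBound, Set.mem_ofPred_eq, not_forall, not_le] at hω
    obtain ⟨z, hz, w, hw, h⟩ := hω
    simp only [Set.mem_iUnion]
    exact ⟨(z, w), Finset.mem_product.2 ⟨hz, hw⟩, h.le⟩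
  have hb : ∀ q ∈ gridVectors m 16 ×ˢ gridVectors m 16,
      (bernPi P).real {ω | 560 * m * D ≤ lightSum P s D ω q.1 q.2} ≤ Real.exp (-(48 * m)) := by
    rintro ⟨z, w⟩ hq
    obtain ⟨hz, hw⟩ := Finset.mem_product.1 hq
    have hz := mem_gridVectors.1 hz
    have hw := mem_gridVectors.1 hw
    refine (bernPi_lightSum_tail hD h0 h1 hP hs0 hs1 z w _).trans (Real.exp_le_exp.2 ?_)
    push_cast at hz hw
    have : p / D ^ 2 * (∑ i, (z i : ℝ) ^ 2) * (∑ j, (w j : ℝ) ^ 2) ≤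
        p / D ^ 2 * (16 * m) * (16 * m) := by gcongr
    have e : p / D ^ 2 * (16 * m) * (16 * m) = 512 * m := by linear_combination 256 * m * hpD
    linarith
  have hc := card_gridVectors_le m 16
  push_cast at hc
  calc _ ≤ _ := measureReal_mono hsub (measure_ne_top _ _)
    _ ≤ ∑ q ∈ gridVectors m 16 ×ˢ gridVectors m 16,
        (bernPi P).real {ω | 560 * m * D ≤ lightSum P s D ω q.1 q.2} :=
        measureReal_biUnion_finset_le _ _
    _ ≤ ((gridVectors m 16).card : ℝ) * (gridVectors m 16).card * Real.exp (-(48 * m)) := by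
        refine (Finset.sum_le_sum hb).trans (le_of_eq ?_)
        rw [Finset.sum_const, Finset.card_product, nsmul_eq_mul]; push_cast; ring
    _ ≤ Real.exp ((16 + 2) * m) * Real.exp ((16 + 2) * m) * Real.exp (-(48 * m)) := by gcongr
    _ ≤ Real.exp (-m) := by
        rw [← Real.exp_add, ← Real.exp_add]
        apply Real.exp_le_exp.2
        have : (0 : ℝ) ≤ m := Nat.cast_nonneg m
        linarith

/-- All row and column counts of the indicators are at most `4 d`. -/
def RowColBound {m : ℕ} (d : ℝ) (ω : Fin m → Fin m → Bool) : Prop :=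
  (∀ i, ∑ j, edgeVal (ω i j) ≤ 4 * d) ∧ ∀ j, ∑ i, edgeVal (ω i j) ≤ 4 * d

lemma bernPi_finset_upper_tail {m : ℕ} {P : Fin m → Fin m → ℝ} {d : ℝ} (hd : 0 ≤ d)
    (h0 : ∀ i j, 0 ≤ P i j) (h1 : ∀ i j, P i j ≤ 1) {F : Finset (Fin m × Fin m)}
    (hF : ∑ e ∈ F, P e.1 e.2 ≤ d) :
    (bernPi P).real {ω | 4 * d ≤ ∑ e ∈ F, edgeVal (ω e.1 e.2)} ≤ Real.exp (-(2 * d)) := by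
  have h := bernPi_chernoff_finset h0 h1 F 1 (4 * d)
  simp only [one_mul] at h
  refine h.trans (Real.exp_le_exp.2 ?_)
  have he := Real.exp_one_lt_d9
  have he' := Real.add_one_le_exp (1 : ℝ)
  have : (∑ e ∈ F, P e.1 e.2) * (Real.exp 1 - 1) ≤ d * 2 := by
    apply mul_le_mul hF <;> linarith
  linarith

lemma bernPi_not_rowColBound {m : ℕ} {P : Fin m → Fin m → ℝ} {d : ℝ} (hd : 0 ≤ d)
    (h0 : ∀ i j, 0 ≤ P i j) (h1 : ∀ i j, P i j ≤ 1)
    (hrow : ∀ i, ∑ j, P i j ≤ d) (hcol : ∀ j, ∑ i, P i j ≤ d) :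
    (bernPi P).real {ω | ¬ RowColBound d ω} ≤ 2 * m * Real.exp (-(2 * d)) := by
  classical
  have := bernPi_isProbabilityMeasure h0 h1
  have hsub : {ω | ¬ RowColBound d ω} ⊆
      (⋃ i ∈ (Finset.univ : Finset (Fin m)),
        {ω | 4 * d ≤ ∑ e ∈ {i} ×ˢ (Finset.univ : Finset (Fin m)), edgeVal (ω e.1 e.2)}) ∪
      (⋃ j ∈ (Finset.univ : Finset (Fin m)),
        {ω | 4 * d ≤ ∑ e ∈ (Finset.univ : Finset (Fin m)) ×ˢ {j}, edgeVal (ω e.1 e.2)}) := by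
    intro ω hω
    simp only [RowColBound, Set.mem_ofPred_eq, not_and_or, not_forall, not_le] at hω
    simp only [Finset.mem_univ, Set.iUnion_true, Set.mem_union, Set.mem_iUnion, Set.mem_ofPred_eq,
      Finset.sum_product, Finset.sum_singleton]
    exact hω.imp (fun ⟨i, h⟩ => ⟨i, h.le⟩) (fun ⟨i, h⟩ => ⟨i, h.le⟩)
  refine (measureReal_mono hsub (measure_ne_top _ _)).trans ((measureReal_union_le _ _).trans ?_)
  have hr : ∀ i, (bernPi P).real {ω | 4 * d ≤
      ∑ e ∈ {i} ×ˢ (Finset.univ : Finset (Fin m)), edgeVal (ω e.1 e.2)} ≤ Real.exp (-(2 * d)) :=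
    fun i => bernPi_finset_upper_tail hd h0 h1 (by simpa [Finset.sum_product] using hrow i)
  have hc : ∀ j, (bernPi P).real {ω | 4 * d ≤
      ∑ e ∈ (Finset.univ : Finset (Fin m)) ×ˢ {j}, edgeVal (ω e.1 e.2)} ≤ Real.exp (-(2 * d)) :=
    fun j => bernPi_finset_upper_tail hd h0 h1 (by simpa [Finset.sum_product] using hcol j)
  have s1 := (measureReal_biUnion_finset_le (μ := bernPi P) Finset.univ _).trans
    (Finset.sum_le_sum fun i (_ : i ∈ Finset.univ) => hr i)
  have s2 := (measureReal_biUnion_finset_le (μ := bernPi P) Finset.univ _).trans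
    (Finset.sum_le_sum fun i (_ : i ∈ Finset.univ) => hc i)
  rw [Finset.sum_const, Finset.card_univ, Fintype.card_fin, nsmul_eq_mul] at s1 s2
  linarith

/-- The unordered pairs containing `i`, each written with its smaller vertex first. -/
def starPairs {m : ℕ} (i : Fin m) : Finset (Fin m × Fin m) :=
  Finset.univ.image fun j => if i ≤ j then (i, j) else (j, i)

lemma sum_starPairs {m : ℕ} (i : Fin m) (g : Fin m → Fin m → ℝ) :
    ∑ e ∈ starPairs i, g e.1 e.2 = ∑ j, if i ≤ j then g i j else g j i := by
  rw [starPairs, Finset.sum_image]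
  · refine Finset.sum_congr rfl fun j _ => ?_
    split_ifs <;> rfl
  · intro j _ k _ h
    dsimp only at h
    split_ifs at h <;> simp only [Prod.mk.injEq] at h <;> grind

lemma bernPi_deg_lower_tail {m : ℕ} {P : Fin m → Fin m → ℝ} {d : ℝ} (hd : 0 ≤ d)
    (h0 : ∀ i j, 0 ≤ P i j) (h1 : ∀ i j, P i j ≤ 1) (hsymm : ∀ i j, P i j = P j i)
    (hrow : ∀ i, ∑ j, P i j = d) :
    (bernPi P).real {ω | ¬ ∀ i, d / 10 < deg ω i} ≤ m * Real.exp (-(d / 2)) := by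
  have := bernPi_isProbabilityMeasure h0 h1
  have hdeg : ∀ i (ω : Fin m → Fin m → Bool),
      deg ω i = ∑ e ∈ starPairs i, edgeVal (ω e.1 e.2) := by
    intro i ω
    rw [sum_starPairs i fun k l => edgeVal (ω k l)]
    rfl
  have hP : ∀ i, ∑ e ∈ starPairs i, P e.1 e.2 = d := by
    intro i
    rw [sum_starPairs, ← hrow i]
    refine Finset.sum_congr rfl fun j _ => ?_
    split_ifs
    · rfl
    · exact hsymm j i
  have hb : ∀ i, (bernPi P).real {ω | deg ω i ≤ d / 10} ≤ Real.exp (-(d / 2)) := by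
    intro i
    have h := bernPi_chernoff_finset h0 h1 (starPairs i) (-1) (d / 10)
    simp only [← hdeg, hP] at h
    have hset : {ω : Fin m → Fin m → Bool | deg ω i ≤ d / 10} =
        {ω | -1 * (d / 10) ≤ -1 * deg ω i} := by
      ext ω; simp only [Set.mem_ofPred_eq]; constructor <;> intro h <;> linarith
    rw [hset]
    refine h.trans (Real.exp_le_exp.2 ?_)
    have he : Real.exp (-1) ≤ 0.4 := by
      rw [Real.exp_neg]
      have := Real.exp_one_gt_d9
      calc (Real.exp 1)⁻¹ ≤ (2.5 : ℝ)⁻¹ := inv_anti₀ (by norm_num) (by linarith)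
        _ = 0.4 := by norm_num
    nlinarith
  have hsub : {ω : Fin m → Fin m → Bool | ¬ ∀ i, d / 10 < deg ω i} ⊆
      ⋃ i ∈ (Finset.univ : Finset (Fin m)), {ω | deg ω i ≤ d / 10} := by
    intro ω hω
    simpa using hω
  refine (measureReal_mono hsub (measure_ne_top _ _)).trans
    ((measureReal_biUnion_finset_le _ _).trans ?_)
  refine (Finset.sum_le_sum fun i _ => hb i).trans ?_
  simp

lemma sum_four_pow_le_of_cutoff (N : ℕ) {X : ℝ} (hX : 0 ≤ X) :
    ∑ k ∈ Finset.range N, (if (4 : ℝ) ^ k ≤ X then (4 : ℝ) ^ k else 0) ≤ 2 * X := by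
  induction N with
  | zero => simpa using hX
  | succ N ih =>
    by_cases h : (4 : ℝ) ^ N ≤ X
    · have h1 : ∑ k ∈ Finset.range (N + 1), (if (4 : ℝ) ^ k ≤ X then (4 : ℝ) ^ k else 0) ≤
          ∑ k ∈ Finset.range (N + 1), (4 : ℝ) ^ k := by
        refine Finset.sum_le_sum fun k _ => ?_
        split_ifs
        · exact le_rfl
        · positivity
      rw [geom_sum_eq (by norm_num), pow_succ] at h1
      have : (0 : ℝ) < 4 ^ N := by positivity
      linarith
    · rw [Finset.sum_range_succ, if_neg h, add_zero]
      exact ih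

lemma sum_inv_two_pow_le (N : ℕ) : ∑ l ∈ Finset.range N, (1 : ℝ) / 2 ^ l ≤ 2 := by
  simpa [one_div, inv_pow] using sum_geometric_two_le N

/-- A block whose edge count obeys the entropy bound of its second index is dominated by
summable quantities. -/
lemma block_le_of_entropy {m p D s t x y r : ℝ} (l : ℕ) (hm : 0 < m) (hp : 0 < p)
    (hD : 0 < D) (hs : 1 ≤ s) (ht : 1 ≤ t) (htm : t ≤ m) (hx : 0 < x) (hy : y = 4 ^ l)
    (ht2 : t * 16 ^ l ≤ 16 * m)
    (hr : Real.exp 2 * (p * s * t) < r)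
    (hent : r * Real.log (r / (p * s * t)) ≤ 12 * choiceCost m t) :
    x * y * r ≤ x ^ 2 * r / D + (if x ≤ D then x else 0) * (768 * m * (1 / 2 ^ l)) +
      (if x ≤ D * y then x else 0) * (48 * t * y) +
      p * (s * x ^ 2) / D * (16 * m * (1 / 2 ^ l)) := by
  have hy0 : 0 < y := by rw [hy]; positivity
  have hμ : 0 < p * s * t := by positivity
  have hr0 : 0 < r := lt_trans (by positivity) hr
  set g := Real.log (r / (p * s * t)) with hg
  have hg2 : 2 ≤ g := by
    rw [hg, Real.le_log_iff_exp_le (by positivity), le_div_iff₀ hμ]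
    exact hr.le
  set f := Real.exp ((1 + Real.log (m / t)) / 4) with hf
  have hlogmt : 0 ≤ Real.log (m / t) := Real.log_nonneg (by rw [le_div_iff₀] <;> linarith)
  have hlogf : Real.log f = (1 + Real.log (m / t)) / 4 := Real.log_exp _
  have hf0 : 0 < f := Real.exp_pos _
  have hcost : choiceCost m t = 4 * (t * Real.log f) := by rw [hlogf, choiceCost]; ring
  have hf4 : f ^ 4 = Real.exp 1 * (m / t) := by
    rw [hf, ← Real.exp_nat_mul, ← Real.exp_log (show 0 < m / t by positivity), ← Real.exp_add,
      Real.log_exp]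
    congr 1; push_cast; ring
  have htf : t * f ≤ 16 * m / 8 ^ l := by
    refine le_of_pow_le_pow_left₀ (n := 4) (by norm_num) (by positivity) ?_
    have he : Real.exp 1 ≤ 16 := by have := Real.exp_one_lt_d9; linarith
    have h3 : (t * 16 ^ l) ^ 3 ≤ (16 * m) ^ 3 := by gcongr
    have h8 : ((8 : ℝ) ^ l) ^ 4 = (16 ^ l) ^ 3 := by
      rw [← pow_mul, ← pow_mul, mul_comm l 4, mul_comm l 3, pow_mul, pow_mul]; norm_num
    rw [mul_pow, hf4, div_pow, h8, le_div_iff₀ (by positivity)]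
    calc t ^ 4 * (Real.exp 1 * (m / t)) * (16 ^ l) ^ 3
        = Real.exp 1 * m * (t * 16 ^ l) ^ 3 := by field_simp
      _ ≤ 16 * m * (16 * m) ^ 3 := by gcongr
      _ = (16 * m) ^ 4 := by ring
  have hy8 : y * (16 * m / 8 ^ l) = 16 * m * (1 / 2 ^ l) := by
    have : (8 : ℝ) ^ l = 4 ^ l * 2 ^ l := by rw [← mul_pow]; norm_num
    rw [hy, this]; field_simp
  have hytf : y * (t * f) ≤ 16 * m * (1 / 2 ^ l) := by
    rw [← hy8]; gcongr
  have n1 : 0 ≤ x ^ 2 * r / D := by positivity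
  have n2 : 0 ≤ (if x ≤ D then x else 0) * (768 * m * (1 / 2 ^ l)) := by
    split_ifs <;> positivity
  have n3 : 0 ≤ (if x ≤ D * y then x else 0) * (48 * t * y) := by split_ifs <;> positivity
  have n4 : 0 ≤ p * (s * x ^ 2) / D * (16 * m * (1 / 2 ^ l)) := by positivity
  by_cases h1 : x ≤ D * y
  swap
  · have : x * y * r ≤ x ^ 2 * r / D := by
      rw [le_div_iff₀ hD]
      have : 0 ≤ x * r * (x - D * y) := mul_nonneg (by positivity) (by linarith)
      nlinarith
    linarith
  by_cases h2 : x ≤ D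
  · have hrle : r ≤ 48 * (t * f) := by
      have a1 : r * 1 ≤ r * g := by gcongr; linarith
      have a2 : Real.log f ≤ f := (Real.log_le_sub_one_of_pos hf0).trans (by linarith)
      have a3 : t * Real.log f ≤ t * f := by gcongr
      linarith
    have : x * y * r ≤ x * (768 * m * (1 / 2 ^ l)) := by
      calc x * y * r ≤ x * y * (48 * (t * f)) := by gcongr
        _ = x * (48 * (y * (t * f))) := by ring
        _ ≤ x * (48 * (16 * m * (1 / 2 ^ l))) := by gcongr
        _ = _ := by ring
    rw [if_pos h2] at n2 ⊢
    linarith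
  by_cases h3 : p * s * t * f ≤ r
  · have hlf : 0 < Real.log f := by rw [hlogf]; positivity
    have hle : Real.log f ≤ g := by
      apply Real.log_le_log hf0
      rw [le_div_iff₀ hμ]; linarith
    have hrle : r ≤ 48 * t := by
      have a1 : r * Real.log f ≤ r * g := by gcongr
      have a2 : r * Real.log f ≤ 48 * t * Real.log f := by linarith
      exact le_of_mul_le_mul_right a2 hlf
    have : x * y * r ≤ x * (48 * t * y) := by
      calc x * y * r ≤ x * y * (48 * t) := by gcongr
        _ = _ := by ring
    rw [if_pos h1] at n3 ⊢
    linarith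
  · have : x * y * r ≤ p * (s * x ^ 2) / D * (16 * m * (1 / 2 ^ l)) := by
      calc x * y * r ≤ x * y * (p * s * t * f) := by gcongr; linarith
        _ = p * (s * x ^ 2) / x * (y * (t * f)) := by field_simp
        _ ≤ p * (s * x ^ 2) / D * (16 * m * (1 / 2 ^ l)) := by
            gcongr
            linarith
    linarith

lemma sum_blocks_le_of_entropy {m d p D : ℝ} (N : ℕ) {s t : ℕ → ℝ} {r : ℕ → ℕ → ℝ}
    (hm : 0 < m) (hp : 0 < p) (hD : 0 < D) (hDd : D ^ 2 = d) (hpm : p * m = 2 * d)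
    (hs0 : ∀ k, 0 ≤ s k) (ht0 : ∀ l, 0 ≤ t l) (htm : ∀ l, t l ≤ m) (hr0 : ∀ k l, 0 ≤ r k l)
    (hs : ∑ k ∈ Finset.range N, s k * 16 ^ k ≤ 16 * m)
    (ht : ∑ l ∈ Finset.range N, t l * 16 ^ l ≤ 16 * m)
    (hrow : ∀ k, ∑ l ∈ Finset.range N, r k l ≤ 4 * d * s k)
    (Q : ℕ → ℕ → Prop) [∀ k l, Decidable (Q k l)]
    (hQ : ∀ k l, Q k l → 1 ≤ s k ∧ 1 ≤ t l ∧ Real.exp 2 * (p * s k * t l) < r k l ∧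
      r k l * Real.log (r k l / (p * s k * t l)) ≤ 12 * choiceCost m (t l)) :
    ∑ k ∈ Finset.range N, ∑ l ∈ Finset.range N, (if Q k l then 4 ^ k * 4 ^ l * r k l else 0) ≤
      5696 * m * D := by
  have hx2 : ∀ k : ℕ, ((4 : ℝ) ^ k) ^ 2 = 16 ^ k := fun k => by
    rw [← pow_mul, mul_comm, pow_mul]; norm_num
  have hpt : ∀ k ∈ Finset.range N, ∀ l ∈ Finset.range N,
      (if Q k l then 4 ^ k * 4 ^ l * r k l else 0) ≤
      16 ^ k / D * r k l + (if (4 : ℝ) ^ k ≤ D then 4 ^ k else 0) * (768 * m * (1 / 2 ^ l)) +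
      (if (4 : ℝ) ^ k ≤ D * 4 ^ l then 4 ^ k else 0) * (48 * t l * 4 ^ l) +
      p * (s k * 16 ^ k) / D * (16 * m * (1 / 2 ^ l)) := by
    intro k _ l hl
    by_cases hq : Q k l
    · rw [if_pos hq]
      obtain ⟨q1, q2, q3, q4⟩ := hQ k l hq
      have hsingle : t l * 16 ^ l ≤ 16 * m :=
        (Finset.single_le_sum (f := fun l => t l * 16 ^ l)
          (fun i _ => mul_nonneg (ht0 i) (by positivity)) hl).trans ht
      have := block_le_of_entropy (x := 4 ^ k) l hm hp hD q1 q2 (htm l) (by positivity) rfl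
        hsingle q3 q4
      rw [hx2] at this
      refine this.trans (le_of_eq ?_)
      ring
    · rw [if_neg hq]
      have h1 := hs0 k
      have h2 := ht0 l
      have h3 := hr0 k l
      have h4 : 0 ≤ (if (4 : ℝ) ^ k ≤ D then (4 : ℝ) ^ k else 0) := by split_ifs <;> positivity
      have h5 : 0 ≤ (if (4 : ℝ) ^ k ≤ D * 4 ^ l then (4 : ℝ) ^ k else 0) := by
        split_ifs <;> positivity
      refine add_nonneg (add_nonneg (add_nonneg ?_ (mul_nonneg h4 ?_)) (mul_nonneg h5 ?_)) ?_ <;>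
        positivity
  refine (Finset.sum_le_sum fun k hk => Finset.sum_le_sum fun l hl => hpt k hk l hl).trans ?_
  simp only [Finset.sum_add_distrib]
  have e1 : ∑ k ∈ Finset.range N, ∑ l ∈ Finset.range N, 16 ^ k / D * r k l ≤ 64 * m * D := by
    calc _ = ∑ k ∈ Finset.range N, 16 ^ k / D * ∑ l ∈ Finset.range N, r k l := by
          simp only [Finset.mul_sum]
      _ ≤ ∑ k ∈ Finset.range N, 16 ^ k / D * (4 * d * s k) :=
          Finset.sum_le_sum fun k _ => mul_le_mul_of_nonneg_left (hrow k) (by positivity)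
      _ = 4 * D * ∑ k ∈ Finset.range N, s k * 16 ^ k := by
          rw [Finset.mul_sum]
          refine Finset.sum_congr rfl fun k _ => ?_
          rw [← hDd]; field_simp
      _ ≤ 4 * D * (16 * m) := by gcongr
      _ = _ := by ring
  have e2 : ∑ k ∈ Finset.range N, ∑ l ∈ Finset.range N,
      (if (4 : ℝ) ^ k ≤ D then (4 : ℝ) ^ k else 0) * (768 * m * (1 / 2 ^ l)) ≤ 3072 * m * D := by
    rw [← Finset.sum_mul_sum, ← Finset.mul_sum]
    calc _ ≤ 2 * D * (768 * m * 2) := by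
          refine mul_le_mul (sum_four_pow_le_of_cutoff N hD.le) ?_ ?_ (by positivity)
          · exact mul_le_mul_of_nonneg_left (sum_inv_two_pow_le N) (by positivity)
          · exact mul_nonneg (by positivity) (Finset.sum_nonneg fun _ _ => by positivity)
      _ = _ := by ring
  have e3 : ∑ k ∈ Finset.range N, ∑ l ∈ Finset.range N,
      (if (4 : ℝ) ^ k ≤ D * 4 ^ l then (4 : ℝ) ^ k else 0) * (48 * t l * 4 ^ l) ≤
      1536 * m * D := by
    rw [Finset.sum_comm]
    calc _ = ∑ l ∈ Finset.range N, (∑ k ∈ Finset.range N,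
          (if (4 : ℝ) ^ k ≤ D * 4 ^ l then (4 : ℝ) ^ k else 0)) * (48 * t l * 4 ^ l) := by
          simp only [Finset.sum_mul]
      _ ≤ ∑ l ∈ Finset.range N, (2 * (D * 4 ^ l)) * (48 * t l * 4 ^ l) :=
          Finset.sum_le_sum fun l _ => mul_le_mul_of_nonneg_right
            (sum_four_pow_le_of_cutoff N (by positivity))
            (mul_nonneg (mul_nonneg (by norm_num) (ht0 l)) (by positivity))
      _ = 96 * D * ∑ l ∈ Finset.range N, t l * 16 ^ l := by
          rw [Finset.mul_sum]
          refine Finset.sum_congr rfl fun l _ => ?_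
          rw [← hx2]; ring
      _ ≤ 96 * D * (16 * m) := by gcongr
      _ = _ := by ring
  have e4 : ∑ k ∈ Finset.range N, ∑ l ∈ Finset.range N,
      p * (s k * 16 ^ k) / D * (16 * m * (1 / 2 ^ l)) ≤ 1024 * m * D := by
    rw [← Finset.sum_mul_sum, ← Finset.mul_sum, ← Finset.sum_div, ← Finset.mul_sum]
    calc _ ≤ p * (16 * m) / D * (16 * m * 2) := by
          have h0 : 0 ≤ ∑ k ∈ Finset.range N, s k * 16 ^ k :=
            Finset.sum_nonneg fun k _ => mul_nonneg (hs0 k) (by positivity)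
          have := sum_inv_two_pow_le N
          gcongr
      _ = 512 * m * (p * m) / D := by ring
      _ = _ := by rw [hpm, ← hDd]; field_simp; norm_num
  linarith

/-- The coordinates whose absolute value lies in `[4 ^ k, 4 ^ (k + 1))`. -/
def levelSet {m : ℕ} (z : Fin m → ℤ) (k : ℕ) : Finset (Fin m) :=
  Finset.univ.filter fun i => z i ≠ 0 ∧ Nat.log 4 (z i).natAbs = k

lemma sum_levelSet {m N : ℕ} {z : Fin m → ℤ} (hN : ∀ i, Nat.log 4 (z i).natAbs < N)
    (f : Fin m → ℝ) :
    ∑ k ∈ Finset.range N, ∑ i ∈ levelSet z k, f i =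
      ∑ i ∈ Finset.univ.filter (fun i => z i ≠ 0), f i := by
  rw [← Finset.sum_fiberwise_of_maps_to (s := Finset.univ.filter (fun i => z i ≠ 0))
    (t := Finset.range N) (g := fun i => Nat.log 4 (z i).natAbs)
    (fun i _ => Finset.mem_range.2 (hN i))]
  refine Finset.sum_congr rfl fun k _ => ?_
  rw [Finset.filter_filter, levelSet]

lemma sum_levelSet_le {m N : ℕ} {z : Fin m → ℤ} (hN : ∀ i, Nat.log 4 (z i).natAbs < N)
    {f : Fin m → ℝ} (hf : ∀ i, 0 ≤ f i) :
    ∑ k ∈ Finset.range N, ∑ i ∈ levelSet z k, f i ≤ ∑ i, f i := by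
  rw [sum_levelSet hN]
  exact Finset.sum_le_sum_of_subset_of_nonneg (Finset.filter_subset _ _) fun i _ _ => hf i

lemma levelSet_bounds {m k : ℕ} {z : Fin m → ℤ} {i : Fin m} (hi : i ∈ levelSet z k) :
    (4 : ℝ) ^ k ≤ |(z i : ℝ)| ∧ |(z i : ℝ)| ≤ 4 * 4 ^ k := by
  simp only [levelSet, Finset.mem_filter, Finset.mem_univ, true_and] at hi
  obtain ⟨h0, rfl⟩ := hi
  have h1 := Nat.pow_log_le_self 4 (Int.natAbs_ne_zero.2 h0)
  have h2 := Nat.lt_pow_succ_log_self (b := 4) (by norm_num) (z i).natAbs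
  have e : |(z i : ℝ)| = ((z i).natAbs : ℝ) := by rw [Nat.cast_natAbs, Int.cast_abs]
  rw [e]
  refine ⟨by exact_mod_cast h1, ?_⟩
  rw [mul_comm, ← pow_succ]
  exact_mod_cast h2.le

lemma log_natAbs_lt_of_mem_gridVectors {m K : ℕ} {z : Fin m → ℤ} (hz : z ∈ gridVectors m K)
    (i : Fin m) : Nat.log 4 (z i).natAbs < K * m + 1 := by
  simp only [gridVectors, Finset.mem_filter, Fintype.mem_piFinset, Finset.mem_Icc] at hz
  have h1 := hz.1 i
  have h2 := Nat.log_le_self 4 (z i).natAbs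
  omega

lemma sum_card_levelSet_le {m K : ℕ} {z : Fin m → ℤ} (hz : z ∈ gridVectors m K) :
    ∑ k ∈ Finset.range (K * m + 1), ((levelSet z k).card : ℝ) * 16 ^ k ≤ K * m := by
  refine le_trans ?_ (mem_gridVectors.1 hz)
  refine le_trans (Finset.sum_le_sum fun k _ => ?_)
    (sum_levelSet_le (log_natAbs_lt_of_mem_gridVectors hz) fun i => sq_nonneg (z i : ℝ))
  rw [← nsmul_eq_mul]
  refine Finset.card_nsmul_le_sum _ _ _ fun i hi => ?_
  have h := (levelSet_bounds hi).1
  rw [← sq_abs, show (16 : ℝ) ^ k = (4 ^ k) ^ 2 by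
    rw [← pow_mul, mul_comm, pow_mul]; norm_num]
  gcongr

lemma edgeCount_nonneg {m : ℕ} (ω : Fin m → Fin m → Bool) (S T : Finset (Fin m)) :
    0 ≤ edgeCount ω S T :=
  Finset.sum_nonneg fun _ _ => Finset.sum_nonneg fun _ _ => edgeVal_nonneg _

lemma sum_edgeCount_levelSet_row {m K : ℕ} {d : ℝ} {ω : Fin m → Fin m → Bool}
    (hω : RowColBound d ω) {w : Fin m → ℤ} (hw : w ∈ gridVectors m K) (S : Finset (Fin m)) :
    ∑ l ∈ Finset.range (K * m + 1), edgeCount ω S (levelSet w l) ≤ 4 * d * S.card := by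
  unfold edgeCount
  rw [Finset.sum_comm]
  calc _ ≤ ∑ i ∈ S, 4 * d := Finset.sum_le_sum fun i _ =>
        (sum_levelSet_le (log_natAbs_lt_of_mem_gridVectors hw) fun j => edgeVal_nonneg _).trans
          (hω.1 i)
    _ = _ := by rw [Finset.sum_const, nsmul_eq_mul]; ring

lemma sum_edgeCount_levelSet_col {m K : ℕ} {d : ℝ} {ω : Fin m → Fin m → Bool}
    (hω : RowColBound d ω) {z : Fin m → ℤ} (hz : z ∈ gridVectors m K) (T : Finset (Fin m)) :
    ∑ k ∈ Finset.range (K * m + 1), edgeCount ω (levelSet z k) T ≤ 4 * d * T.card := by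
  have e : ∀ k, edgeCount ω (levelSet z k) T = ∑ j ∈ T, ∑ i ∈ levelSet z k, edgeVal (ω i j) :=
    fun k => Finset.sum_comm
  simp only [e]
  rw [Finset.sum_comm]
  calc _ ≤ ∑ j ∈ T, 4 * d := Finset.sum_le_sum fun j _ =>
        (sum_levelSet_le (log_natAbs_lt_of_mem_gridVectors hz) fun i => edgeVal_nonneg _).trans
          (hω.2 j)
    _ = _ := by rw [Finset.sum_const, nsmul_eq_mul]; ring

lemma sum_blocks_le_of_discrepancy {m d p D : ℝ} (N : ℕ) {s t : ℕ → ℝ} {r : ℕ → ℕ → ℝ}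
    (hm : 0 < m) (hp : 0 < p) (hD : 0 < D) (hDd : D ^ 2 = d) (hpm : p * m = 2 * d)
    (hs0 : ∀ k, 0 ≤ s k) (ht0 : ∀ l, 0 ≤ t l) (hsm : ∀ k, s k ≤ m) (htm : ∀ l, t l ≤ m)
    (hr0 : ∀ k l, 0 ≤ r k l)
    (hs : ∑ k ∈ Finset.range N, s k * 16 ^ k ≤ 16 * m)
    (ht : ∑ l ∈ Finset.range N, t l * 16 ^ l ≤ 16 * m)
    (hrow : ∀ k, ∑ l ∈ Finset.range N, r k l ≤ 4 * d * s k)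
    (hcol : ∀ l, ∑ k ∈ Finset.range N, r k l ≤ 4 * d * t l)
    (hdisc : ∀ k l, r k l = 0 ∨ 1 ≤ s k ∧ 1 ≤ t l ∧ (r k l ≤ Real.exp 2 * (p * s k * t l) ∨
      r k l * Real.log (r k l / (p * s k * t l)) ≤
        6 * (choiceCost m (s k) + choiceCost m (t l)))) :
    ∑ k ∈ Finset.range N, ∑ l ∈ Finset.range N,
      (if D < 16 * (4 ^ k * 4 ^ l) then 4 ^ k * 4 ^ l * r k l else 0) ≤ 80000 * m * D := by
  classical
  let Q : ℕ → ℕ → Prop := fun k l => 1 ≤ s k ∧ 1 ≤ t l ∧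
    Real.exp 2 * (p * s k * t l) < r k l ∧
    r k l * Real.log (r k l / (p * s k * t l)) ≤ 12 * choiceCost m (t l)
  let Q' : ℕ → ℕ → Prop := fun l k => 1 ≤ t l ∧ 1 ≤ s k ∧
    Real.exp 2 * (p * t l * s k) < r k l ∧
    r k l * Real.log (r k l / (p * t l * s k)) ≤ 12 * choiceCost m (s k)
  have h1 : ∑ k ∈ Finset.range N, ∑ l ∈ Finset.range N,
      (if Q k l then 4 ^ k * 4 ^ l * r k l else 0) ≤ 5696 * m * D :=
    sum_blocks_le_of_entropy N hm hp hD hDd hpm hs0 ht0 htm hr0 hs ht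
      hrow Q (fun k l h => h)
  have h2 : ∑ l ∈ Finset.range N, ∑ k ∈ Finset.range N,
      (if Q' l k then 4 ^ l * 4 ^ k * r k l else 0) ≤ 5696 * m * D :=
    sum_blocks_le_of_entropy N (r := fun l k => r k l) hm hp hD hDd hpm ht0 hs0
      hsm (fun l k => hr0 k l) ht hs hcol Q' (fun k l h => h)
  rw [Finset.sum_comm] at h2
  have h3 : ∑ k ∈ Finset.range N, ∑ l ∈ Finset.range N,
      128 * p / D * (s k * 16 ^ k) * (t l * 16 ^ l) ≤ 65536 * m * D := by
    rw [← Finset.sum_mul_sum, ← Finset.mul_sum]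
    calc _ ≤ 128 * p / D * (16 * m) * (16 * m) := by
          have : 0 ≤ ∑ l ∈ Finset.range N, t l * 16 ^ l :=
            Finset.sum_nonneg fun k _ => mul_nonneg (ht0 k) (by positivity)
          gcongr
      _ = 32768 * m * (p * m) / D := by ring
      _ = _ := by rw [hpm, ← hDd]; field_simp; norm_num
  have hx2 : ∀ k : ℕ, (16 : ℝ) ^ k = (4 ^ k) ^ 2 := fun k => by
    rw [← pow_mul, mul_comm, pow_mul]; norm_num
  have hpt : ∀ k l, (if D < 16 * (4 ^ k * 4 ^ l) then 4 ^ k * 4 ^ l * r k l else 0) ≤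
      128 * p / D * (s k * 16 ^ k) * (t l * 16 ^ l) +
      (if Q k l then 4 ^ k * 4 ^ l * r k l else 0) +
      (if Q' l k then 4 ^ l * 4 ^ k * r k l else 0) := by
    intro k l
    have a0 : 0 ≤ 4 ^ k * 4 ^ l * r k l := mul_nonneg (by positivity) (hr0 k l)
    have a1 : 0 ≤ 128 * p / D * (s k * 16 ^ k) * (t l * 16 ^ l) := by
      have := hs0 k
      have := ht0 l
      positivity
    have a2 : 0 ≤ (if Q k l then 4 ^ k * 4 ^ l * r k l else 0) := by
      split_ifs
      · exact a0
      · exact le_rfl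
    have a3 : 0 ≤ (if Q' l k then 4 ^ l * 4 ^ k * r k l else 0) := by
      split_ifs
      · linarith
      · exact le_rfl
    by_cases hh : D < 16 * (4 ^ k * 4 ^ l)
    swap
    · rw [if_neg hh]; positivity
    rw [if_pos hh]
    rcases hdisc k l with h0 | ⟨hs1, ht1, hdisc⟩
    · have : 4 ^ k * 4 ^ l * r k l = 0 := by rw [h0, mul_zero]
      linarith
    by_cases hlow : r k l ≤ Real.exp 2 * (p * s k * t l)
    · have he : Real.exp 2 ≤ 8 := by
        have := Real.exp_one_lt_d9
        have e2 : Real.exp 2 = Real.exp 1 * Real.exp 1 := by rw [← Real.exp_add]; norm_num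
        have := Real.exp_pos (1 : ℝ)
        rw [e2]; nlinarith
      have : 4 ^ k * 4 ^ l * r k l ≤ 128 * p / D * (s k * 16 ^ k) * (t l * 16 ^ l) := by
        calc 4 ^ k * 4 ^ l * r k l ≤ 4 ^ k * 4 ^ l * (8 * (p * s k * t l)) := by
              gcongr
              exact hlow.trans (by gcongr)
          _ = (4 ^ k * 4 ^ l * (8 * (p * s k * t l))) / D * D := by field_simp
          _ ≤ (4 ^ k * 4 ^ l * (8 * (p * s k * t l))) / D * (16 * (4 ^ k * 4 ^ l)) := by
              gcongr
          _ = _ := by rw [hx2, hx2]; ring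
      linarith
    · push Not at hlow
      rcases hdisc with h | h
      · exact absurd h (not_le.2 hlow)
      rcases le_total (choiceCost m (s k)) (choiceCost m (t l)) with hc | hc
      · have hq : Q k l := ⟨hs1, ht1, hlow, h.trans (by linarith)⟩
        rw [if_pos hq]; linarith
      · have e : p * t l * s k = p * s k * t l := by ring
        have hq : Q' l k :=
          ⟨ht1, hs1, by rw [e]; exact hlow, by rw [e]; exact h.trans (by linarith)⟩
        rw [if_pos hq]; linarith
  refine (Finset.sum_le_sum fun k _ => Finset.sum_le_sum fun l _ => hpt k l).trans ?_
  simp only [Finset.sum_add_distrib]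
  have : 0 ≤ m * D := by positivity
  linarith

lemma sum_heavy_blocks_le {m : ℕ} (hm : 1 ≤ m) {d p D : ℝ} (hp : 0 < p) (hD : 0 < D)
    (hDd : D ^ 2 = d) (hpm : p * m = 2 * d) {ω : Fin m → Fin m → Bool} (hrc : RowColBound d ω)
    (hdisc : Discrepancy p ω) {z w : Fin m → ℤ} (hz : z ∈ gridVectors m 16)
    (hw : w ∈ gridVectors m 16) :
    ∑ k ∈ Finset.range (16 * m + 1), ∑ l ∈ Finset.range (16 * m + 1),
      (if D < 16 * (4 ^ k * 4 ^ l) then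
        4 ^ k * 4 ^ l * edgeCount ω (levelSet z k) (levelSet w l) else 0) ≤
      80000 * m * D := by
  have hcard : ∀ S : Finset (Fin m), (S.card : ℝ) ≤ m := fun S => by
    exact_mod_cast S.card_le_univ.trans_eq (Fintype.card_fin m)
  refine sum_blocks_le_of_discrepancy (16 * m + 1)
    (s := fun k => ((levelSet z k).card : ℝ)) (t := fun l => ((levelSet w l).card : ℝ))
    (r := fun k l => edgeCount ω (levelSet z k) (levelSet w l))
    (by exact_mod_cast hm) hp hD hDd hpm (fun k => Nat.cast_nonneg _) (fun l => Nat.cast_nonneg _)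
    (fun k => hcard _) (fun l => hcard _) (fun k l => edgeCount_nonneg _ _ _)
    (by simpa using sum_card_levelSet_le hz) (by simpa using sum_card_levelSet_le hw)
    (fun k => sum_edgeCount_levelSet_row hrc hw (levelSet z k))
    (fun l => sum_edgeCount_levelSet_col hrc hz (levelSet w l)) fun k l => ?_
  rcases (levelSet z k).eq_empty_or_nonempty with hS | hS
  · exact Or.inl (by simp [edgeCount, hS])
  rcases (levelSet w l).eq_empty_or_nonempty with hT | hT
  · exact Or.inl (by simp [edgeCount, hT])
  exact Or.inr ⟨by exact_mod_cast hS.card_pos, by exact_mod_cast hT.card_pos, hdisc _ _ hS hT⟩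

/-- The total weight of the edges whose weight `|z i * w j|` exceeds `√d` is `O(m √d)`. -/
lemma sum_heavy_le {m : ℕ} (hm : 1 ≤ m) {d p D : ℝ} (hp : 0 < p) (hD : 0 < D)
    (hDd : D ^ 2 = d) (hpm : p * m = 2 * d) {ω : Fin m → Fin m → Bool} (hrc : RowColBound d ω)
    (hdisc : Discrepancy p ω) {z w : Fin m → ℤ} (hz : z ∈ gridVectors m 16)
    (hw : w ∈ gridVectors m 16) :
    ∑ i, ∑ j, (if D < |(z i : ℝ) * w j| then |(z i : ℝ) * w j| * edgeVal (ω i j) else 0) ≤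
      1280000 * m * D := by
  set h : Fin m → Fin m → ℝ := fun i j =>
    if D < |(z i : ℝ) * w j| then |(z i : ℝ) * w j| * edgeVal (ω i j) else 0 with hh
  have hN := log_natAbs_lt_of_mem_gridVectors hz
  have hN' := log_natAbs_lt_of_mem_gridVectors hw
  have e1 : ∑ i, ∑ j, h i j = ∑ k ∈ Finset.range (16 * m + 1), ∑ l ∈ Finset.range (16 * m + 1),
      ∑ i ∈ levelSet z k, ∑ j ∈ levelSet w l, h i j := by
    have f1 : ∀ i, ∑ j, h i j =
        ∑ l ∈ Finset.range (16 * m + 1), ∑ j ∈ levelSet w l, h i j := by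
      intro i
      rw [sum_levelSet hN', Finset.sum_filter_of_ne]
      intro j _ hj hw0
      simp [hh, hw0, hD.le.not_gt] at hj
    have f2 : ∑ i, ∑ j, h i j =
        ∑ k ∈ Finset.range (16 * m + 1), ∑ i ∈ levelSet z k, ∑ j, h i j := by
      rw [sum_levelSet hN, Finset.sum_filter_of_ne]
      intro i _ hi hz0
      apply hi
      simp [hh, hz0, hD.le.not_gt]
    rw [f2]
    refine Finset.sum_congr rfl fun k _ => ?_
    rw [Finset.sum_congr rfl fun i _ => f1 i, Finset.sum_comm]
  rw [e1]
  have hb := sum_heavy_blocks_le hm hp hD hDd hpm hrc hdisc hz hw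
  calc _ ≤ ∑ k ∈ Finset.range (16 * m + 1), ∑ l ∈ Finset.range (16 * m + 1),
      16 * (if D < 16 * (4 ^ k * 4 ^ l) then
        4 ^ k * 4 ^ l * edgeCount ω (levelSet z k) (levelSet w l) else 0) := by
        refine Finset.sum_le_sum fun k _ => Finset.sum_le_sum fun l _ => ?_
        have hprod : ∀ i ∈ levelSet z k, ∀ j ∈ levelSet w l,
            |(z i : ℝ) * w j| ≤ 16 * (4 ^ k * 4 ^ l) := by
          intro i hi j hj
          rw [abs_mul]
          calc |(z i : ℝ)| * |(w j : ℝ)| ≤ (4 * 4 ^ k) * (4 * 4 ^ l) :=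
                mul_le_mul (levelSet_bounds hi).2 (levelSet_bounds hj).2 (abs_nonneg _)
                  (by positivity)
            _ = _ := by ring
        split_ifs with hc
        · rw [edgeCount, Finset.mul_sum, Finset.mul_sum]
          refine Finset.sum_le_sum fun i hi => ?_
          rw [Finset.mul_sum, Finset.mul_sum]
          refine Finset.sum_le_sum fun j hj => ?_
          have := edgeVal_nonneg (ω i j)
          simp only [hh]
          split_ifs
          · rw [← mul_assoc]
            exact mul_le_mul_of_nonneg_right (hprod i hi j hj) this
          · positivity
        · rw [mul_zero]
          refine le_of_eq (Finset.sum_eq_zero fun i hi => Finset.sum_eq_zero fun j hj => ?_)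
          exact if_neg fun hlt => hc (hlt.trans_le (hprod i hi j hj))
    _ ≤ 16 * (80000 * m * D) := by
        simp only [← Finset.mul_sum]
        gcongr
    _ = _ := by ring

lemma opNorm_le_of_net {E : Type*} [NormedAddCommGroup E] [InnerProductSpace ℝ E]
    (T : E →L[ℝ] E) {S : Set E} {M : ℝ} (hM : 0 ≤ M)
    (hnet : ∀ x : E, ‖x‖ ≤ 1 → ∃ x' ∈ S, ‖x - x'‖ ≤ 1 / 4) (hS : ∀ x ∈ S, ‖x‖ ≤ 1)
    (h : ∀ x ∈ S, ∀ y ∈ S, inner ℝ x (T y) ≤ M) : ‖T‖ ≤ 2 * M := by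
  have key : ‖T‖ ≤ M + ‖T‖ / 2 := by
    refine T.opNorm_le_of_unit_norm (by positivity) fun y hy => ?_
    rcases eq_or_ne (T y) 0 with h0 | h0
    · rw [h0, norm_zero]; positivity
    have hn : ‖T y‖ ≠ 0 := norm_ne_zero_iff.2 h0
    obtain ⟨y', hy', hyd⟩ := hnet y hy.le
    have hx1 : ‖(‖T y‖⁻¹ • T y)‖ = 1 := by
      rw [norm_smul, norm_inv, norm_norm, inv_mul_cancel₀ hn]
    obtain ⟨x', hx', hxd⟩ := hnet _ hx1.le
    set x := ‖T y‖⁻¹ • T y with hx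
    have e : ‖T y‖ = inner ℝ x (T y) := by
      rw [hx, real_inner_smul_left, real_inner_self_eq_norm_sq, sq, ← mul_assoc,
        inv_mul_cancel₀ hn, one_mul]
    have e2 : inner ℝ x (T y) =
        inner ℝ x' (T y') + inner ℝ (x - x') (T y) + inner ℝ x' (T (y - y')) := by
      rw [map_sub, inner_sub_left, inner_sub_right]; ring
    have b1 : inner ℝ (x - x') (T y) ≤ ‖T‖ / 4 := by
      refine (real_inner_le_norm _ _).trans ?_
      have := T.le_opNorm y
      rw [hy, mul_one] at this
      calc _ ≤ 1 / 4 * ‖T‖ := by gcongr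
        _ = _ := by ring
    have b2 : inner ℝ x' (T (y - y')) ≤ ‖T‖ / 4 := by
      refine (real_inner_le_norm _ _).trans ?_
      have h1 := T.le_opNorm (y - y')
      have h2 := hS _ hx'
      calc _ ≤ 1 * (‖T‖ * (1 / 4)) := by
            gcongr
            exact h1.trans (by gcongr)
        _ = _ := by ring
    have := h x' hx' y' hy'
    linarith
  linarith

lemma exists_int_abs_le_abs_sub_le (u : ℝ) : ∃ z : ℤ, |(z : ℝ)| ≤ |u| ∧ |u - z| ≤ 1 := by
  rcases le_total 0 u with hu | hu
  · refine ⟨⌊u⌋, ?_, ?_⟩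
    · rw [abs_of_nonneg hu, abs_of_nonneg (by exact_mod_cast Int.floor_nonneg.2 hu)]
      exact Int.floor_le u
    · have h1 := Int.floor_le u
      have h2 := Int.lt_floor_add_one u
      rw [abs_le]; constructor <;> linarith
  · have h0 : (⌈u⌉ : ℝ) ≤ 0 := by exact_mod_cast Int.ceil_le.2 (by simpa using hu)
    refine ⟨⌈u⌉, ?_, ?_⟩
    · rw [abs_of_nonpos hu, abs_of_nonpos h0]
      linarith [Int.le_ceil u]
    · have h1 := Int.le_ceil u
      have h2 := Int.ceil_lt_add_one u
      rw [abs_le]; constructor <;> linarith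

lemma inner_toEuclideanCLM_eq_sum {m : ℕ} (M : Matrix (Fin m) (Fin m) ℝ)
    (x y : EuclideanSpace ℝ (Fin m)) :
    inner ℝ x (Matrix.toEuclideanCLM (𝕜 := ℝ) M y) = ∑ i, ∑ j, x i * M i j * y j := by
  rw [PiLp.inner_apply]
  refine Finset.sum_congr rfl fun i _ => ?_
  have : (Matrix.toEuclideanCLM (𝕜 := ℝ) M y) i = ∑ j, M i j * y j := rfl
  rw [this]
  simp only [RCLike.inner_apply, conj_trivial, Finset.sum_mul]
  exact Finset.sum_congr rfl fun j _ => by ring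

/-- It suffices to test the bilinear form of a matrix on integer vectors of length `4 √m`. -/
lemma specNorm_le_of_gridVectors {m : ℕ} (hm : 1 ≤ m) {M : Matrix (Fin m) (Fin m) ℝ} {K : ℝ}
    (hK : 0 ≤ K)
    (h : ∀ z ∈ gridVectors m 16, ∀ w ∈ gridVectors m 16,
      ∑ i, ∑ j, (z i : ℝ) * M i j * w j ≤ 8 * m * K) : specNorm M ≤ K := by
  have hm' : (0 : ℝ) < m := by exact_mod_cast hm
  have hs : 0 < √(m : ℝ) := Real.sqrt_pos.2 hm'
  have hss : √(m : ℝ) ^ 2 = m := Real.sq_sqrt hm'.le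
  have e16 : (16 * m : ℝ) = 4 * √m * (4 * √m) := by linear_combination -16 * hss
  have := opNorm_le_of_net (Matrix.toEuclideanCLM (𝕜 := ℝ) M) (M := K / 2)
    (S := {x | ∃ z ∈ gridVectors m 16, x = WithLp.toLp 2 fun i => (z i : ℝ) / (4 * √m)})
    (by positivity) ?_ ?_ ?_
  · rw [specNorm]; linarith
  · intro x hx
    choose z hz1 hz2 using fun i => exists_int_abs_le_abs_sub_le (4 * √m * x i)
    have hx2 : ∑ i, x i ^ 2 ≤ 1 := by
      rw [← EuclideanSpace.real_norm_sq_eq]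
      exact pow_le_one₀ (norm_nonneg _) hx
    refine ⟨_, ⟨z, mem_gridVectors.2 ?_, rfl⟩, ?_⟩
    · calc ∑ i, (z i : ℝ) ^ 2 ≤ ∑ i, 16 * m * x i ^ 2 := by
            refine Finset.sum_le_sum fun i _ => (sq_le_sq.2 (hz1 i)).trans_eq ?_
            rw [mul_pow, mul_pow, hss]; norm_num
        _ ≤ 16 * m := by
            rw [← Finset.mul_sum]
            exact mul_le_of_le_one_right (by positivity) hx2
        _ = _ := by norm_num
    · refine (pow_le_pow_iff_left₀ (norm_nonneg _) (by norm_num) two_ne_zero).1 ?_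
      rw [EuclideanSpace.real_norm_sq_eq]
      calc _ ≤ ∑ i : Fin m, 1 / (16 * m : ℝ) := by
            refine Finset.sum_le_sum fun i _ => ?_
            have h1 : (4 * √m * x i - z i) ^ 2 ≤ 1 := by
              rw [← sq_abs]; exact pow_le_one₀ (abs_nonneg _) (hz2 i)
            rw [le_div_iff₀ (by positivity)]
            refine le_trans (le_of_eq ?_) h1
            change (x i - z i / (4 * √m)) ^ 2 * _ = _
            rw [e16]; field_simp
        _ ≤ _ := by
            rw [Finset.sum_const, Finset.card_univ, Fintype.card_fin, nsmul_eq_mul]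
            refine le_of_eq ?_
            field_simp; norm_num
  · rintro x ⟨z, hz, rfl⟩
    refine (sq_le_one_iff₀ (norm_nonneg _)).1 ?_
    rw [EuclideanSpace.real_norm_sq_eq]
    simp only [div_pow, ← Finset.sum_div]
    rw [div_le_one (by positivity), mul_pow, hss]
    have := mem_gridVectors.1 hz
    push_cast at this
    linarith
  · rintro _ ⟨z, hz, rfl⟩ _ ⟨w, hw, rfl⟩
    rw [inner_toEuclideanCLM_eq_sum]
    have e : ∑ i, ∑ j, (z i : ℝ) / (4 * √m) * M i j * (w j / (4 * √m)) =
        (∑ i, ∑ j, (z i : ℝ) * M i j * w j) / (16 * m) := by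
      rw [e16]
      simp only [Finset.sum_div]
      refine Finset.sum_congr rfl fun i _ => Finset.sum_congr rfl fun j _ => ?_
      field_simp
    refine e.trans_le ?_
    rw [div_le_iff₀ (by positivity)]
    refine (h z hz w hw).trans_eq (by ring)

/-- The weights that split a symmetric matrix into its upper triangle plus the transpose. -/
noncomputable def halfMask {m : ℕ} (i j : Fin m) : ℝ :=
  if i < j then 1 else if i = j then 1 / 2 else 0

lemma halfMask_nonneg {m : ℕ} (i j : Fin m) : 0 ≤ halfMask i j := by
  unfold halfMask; split_ifs <;> norm_num

lemma halfMask_le_one {m : ℕ} (i j : Fin m) : halfMask i j ≤ 1 := by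
  unfold halfMask; split_ifs <;> norm_num

/-- The centred upper triangle of the adjacency matrix. -/
noncomputable def upperPart {m : ℕ} (P : Fin m → Fin m → ℝ) (ω : Fin m → Fin m → Bool) :
    Matrix (Fin m) (Fin m) ℝ :=
  Matrix.of fun i j => halfMask i j * (edgeVal (ω i j) - P i j)

lemma adjOf_sub_eq_upperPart {m : ℕ} {P : Fin m → Fin m → ℝ} (hP : ∀ i j, P i j = P j i)
    (ω : Fin m → Fin m → Bool) :
    adjOf ω - Matrix.of P = upperPart P ω + (upperPart P ω).transpose := by
  ext i j
  simp only [adjOf, upperPart, Matrix.sub_apply, Matrix.add_apply, Matrix.of_apply,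
    Matrix.transpose_apply, halfMask, edgeVal]
  rcases lt_trichotomy i j with hij | rfl | hij
  · rw [if_pos hij.le, if_pos hij, if_neg hij.not_gt, if_neg hij.ne']; ring
  · simp only [le_refl, if_true, lt_irrefl, if_false]; ring
  · rw [if_neg hij.not_ge, if_neg hij.not_gt, if_neg hij.ne', if_pos hij, hP i j]; ring

lemma specNorm_transpose {m : ℕ} (M : Matrix (Fin m) (Fin m) ℝ) :
    specNorm M.transpose = specNorm M := by
  have : Matrix.toEuclideanCLM (𝕜 := ℝ) M.transpose = star (Matrix.toEuclideanCLM (𝕜 := ℝ) M) := by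
    rw [← map_star, Matrix.star_eq_conjTranspose, Matrix.conjTranspose_eq_transpose_of_trivial]
  rw [specNorm, this, ContinuousLinearMap.star_eq_adjoint, LinearIsometryEquiv.norm_map, specNorm]

lemma specNorm_add_le {m : ℕ} (M N : Matrix (Fin m) (Fin m) ℝ) :
    specNorm (M + N) ≤ specNorm M + specNorm N := by
  rw [specNorm, map_add]; exact norm_add_le _ _

lemma bilin_upperPart_le {m : ℕ} (hm : 1 ≤ m) {P : Fin m → Fin m → ℝ} {d p D : ℝ} (hp : 0 < p)
    (hD : 0 < D) (hDd : D ^ 2 = d) (hpm : p * m = 2 * d) (h0 : ∀ i j, 0 ≤ P i j)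
    (hP : ∀ i j, P i j ≤ p) {ω : Fin m → Fin m → Bool} (hrc : RowColBound d ω)
    (hdisc : Discrepancy p ω) (hlight : LightBound P halfMask D ω) {z w : Fin m → ℤ}
    (hz : z ∈ gridVectors m 16) (hw : w ∈ gridVectors m 16) :
    ∑ i, ∑ j, (z i : ℝ) * upperPart P ω i j * w j ≤ 1281072 * m * D := by
  have hpt : ∀ i j, (z i : ℝ) * upperPart P ω i j * w j ≤
      (if |(z i : ℝ) * w j| ≤ D then
        halfMask i j * ((z i : ℝ) * w j) * (edgeVal (ω i j) - P i j) else 0) +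
      (if D < |(z i : ℝ) * w j| then |(z i : ℝ) * w j| * edgeVal (ω i j) else 0) +
      p / D * ((z i : ℝ) ^ 2 * (w j : ℝ) ^ 2) := by
    intro i j
    have e : (z i : ℝ) * upperPart P ω i j * w j =
        halfMask i j * ((z i : ℝ) * w j) * (edgeVal (ω i j) - P i j) := by
      simp only [upperPart, Matrix.of_apply]; ring
    rw [e]
    have n3 : 0 ≤ p / D * ((z i : ℝ) ^ 2 * (w j : ℝ) ^ 2) := by positivity
    by_cases hc : |(z i : ℝ) * w j| ≤ D
    · rw [if_pos hc, if_neg hc.not_gt]; linarith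
    rw [if_neg hc, if_pos (not_le.1 hc)]
    rw [not_le] at hc
    set u := (z i : ℝ) * w j
    have hu : p / D * ((z i : ℝ) ^ 2 * (w j : ℝ) ^ 2) = p * (|u| * |u|) / D := by
      rw [abs_mul_abs_self]; simp only [u]; ring
    have h1 := halfMask_nonneg i j
    have h2 := halfMask_le_one i j
    have h3 := edgeVal_nonneg (ω i j)
    have hPu : P i j * |u| ≤ p * (|u| * |u|) / D := by
      rw [le_div_iff₀ hD]
      calc P i j * |u| * D ≤ p * |u| * |u| := by
            have := hP i j
            gcongr
        _ = _ := by ring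
    calc halfMask i j * u * (edgeVal (ω i j) - P i j)
        ≤ |halfMask i j * u * (edgeVal (ω i j) - P i j)| := le_abs_self _
      _ = halfMask i j * (|u| * |edgeVal (ω i j) - P i j|) := by
          rw [abs_mul, abs_mul, abs_of_nonneg h1, mul_assoc]
      _ ≤ 1 * (|u| * (edgeVal (ω i j) + P i j)) := by
          have : |edgeVal (ω i j) - P i j| ≤ edgeVal (ω i j) + P i j := by
            have := h0 i j
            rw [abs_le]; constructor <;> linarith
          gcongr
      _ ≤ _ := by rw [hu]; linarith
  refine (Finset.sum_le_sum fun i _ => Finset.sum_le_sum fun j _ => hpt i j).trans ?_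
  simp only [Finset.sum_add_distrib]
  have b1 := hlight z hz w hw
  rw [lightSum] at b1
  have b2 := sum_heavy_le hm hp hD hDd hpm hrc hdisc hz hw
  have b3 : ∑ i, ∑ j, p / D * ((z i : ℝ) ^ 2 * (w j : ℝ) ^ 2) ≤ 512 * m * D := by
    have hz' := mem_gridVectors.1 hz
    have hw' := mem_gridVectors.1 hw
    push_cast at hz' hw'
    simp only [← Finset.mul_sum]
    rw [← Finset.sum_mul]
    calc _ ≤ p / D * ((16 * m) * (16 * m)) := by gcongr
      _ = 256 * m * (p * m) / D := by ring
      _ = _ := by rw [hpm, ← hDd]; field_simp; norm_num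
  linarith

lemma specNorm_adjOf_sub_le {m : ℕ} (hm : 1 ≤ m) {P : Fin m → Fin m → ℝ} {d p D : ℝ} (hp : 0 < p)
    (hD : 0 < D) (hDd : D ^ 2 = d) (hpm : p * m = 2 * d) (h0 : ∀ i j, 0 ≤ P i j)
    (hP : ∀ i j, P i j ≤ p) (hsymm : ∀ i j, P i j = P j i) {ω : Fin m → Fin m → Bool}
    (hrc : RowColBound d ω) (hdisc : Discrepancy p ω) (hlight : LightBound P halfMask D ω) :
    specNorm (adjOf ω - Matrix.of P) ≤ 320268 * D := by
  have h : specNorm (upperPart P ω) ≤ 160134 * D :=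
    specNorm_le_of_gridVectors hm (by positivity) fun z hz w hw =>
      (bilin_upperPart_le hm hp hD hDd hpm h0 hP hrc hdisc hlight hz hw).trans_eq (by ring)
  rw [adjOf_sub_eq_upperPart hsymm]
  refine (specNorm_add_le _ _).trans ?_
  rw [specNorm_transpose]
  linarith

lemma toEuclideanCLM_norm_sq {m : ℕ} (M : Matrix (Fin m) (Fin m) ℝ)
    (x : EuclideanSpace ℝ (Fin m)) :
    ‖Matrix.toEuclideanCLM (𝕜 := ℝ) M x‖ ^ 2 = ∑ i, (∑ j, M i j * x j) ^ 2 :=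
  EuclideanSpace.real_norm_sq_eq _

lemma sum_sq_le_specNorm {m : ℕ} (M : Matrix (Fin m) (Fin m) ℝ) (x : Fin m → ℝ) :
    ∑ i, (∑ j, M i j * x j) ^ 2 ≤ specNorm M ^ 2 * ∑ j, x j ^ 2 := by
  have h := (Matrix.toEuclideanCLM (𝕜 := ℝ) M).le_opNorm (WithLp.toLp 2 x)
  have h2 := pow_le_pow_left₀ (norm_nonneg _) h 2
  rwa [mul_pow, toEuclideanCLM_norm_sq, EuclideanSpace.real_norm_sq_eq] at h2

lemma specNorm_le_of_sum_sq_le {m : ℕ} {M : Matrix (Fin m) (Fin m) ℝ} {K : ℝ} (hK : 0 ≤ K)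
    (h : ∀ x : Fin m → ℝ, ∑ i, (∑ j, M i j * x j) ^ 2 ≤ K ^ 2 * ∑ j, x j ^ 2) :
    specNorm M ≤ K := by
  refine ContinuousLinearMap.opNorm_le_bound _ hK fun x => ?_
  refine (pow_le_pow_iff_left₀ (norm_nonneg _) (by positivity) two_ne_zero).1 ?_
  rw [mul_pow, toEuclideanCLM_norm_sq, EuclideanSpace.real_norm_sq_eq]
  exact h x

lemma specNorm_mul_le {m : ℕ} (M N : Matrix (Fin m) (Fin m) ℝ) :
    specNorm (M * N) ≤ specNorm M * specNorm N := by
  rw [specNorm, map_mul]; exact norm_mul_le _ _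

lemma specNorm_diagonal_le {m : ℕ} {g : Fin m → ℝ} {K : ℝ} (hK : 0 ≤ K)
    (hg : ∀ i, g i ^ 2 ≤ K ^ 2) :
    specNorm (Matrix.diagonal g) ≤ K := by
  refine specNorm_le_of_sum_sq_le hK fun x => ?_
  rw [Finset.mul_sum]
  refine Finset.sum_le_sum fun i _ => ?_
  rw [Finset.sum_eq_single i (fun j _ hj => by rw [Matrix.diagonal_apply_ne _ hj.symm, zero_mul])
    (fun h => absurd (Finset.mem_univ i) h), Matrix.diagonal_apply_eq, mul_pow]
  exact mul_le_mul_of_nonneg_right (hg i) (sq_nonneg _)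

/-- The spectral norm is at most the Frobenius norm. -/
lemma specNorm_le_of_sum_sq_entries_le {m : ℕ} {M : Matrix (Fin m) (Fin m) ℝ} {K : ℝ} (hK : 0 ≤ K)
    (h : ∑ i, ∑ j, M i j ^ 2 ≤ K ^ 2) : specNorm M ≤ K := by
  refine specNorm_le_of_sum_sq_le hK fun x => ?_
  calc _ ≤ ∑ i, (∑ j, M i j ^ 2) * ∑ j, x j ^ 2 :=
        Finset.sum_le_sum fun i _ => Finset.sum_mul_sq_le_sq_mul_sq _ _ _
    _ ≤ _ := by
        rw [← Finset.sum_mul]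
        exact mul_le_mul_of_nonneg_right h (Finset.sum_nonneg fun _ _ => sq_nonneg _)

lemma sq_sqrt_div_sqrt_sub_one_le {d x : ℝ} (hd : 0 < d) (hx : d / 10 < x) :
    (√d / √x - 1) ^ 2 ≤ 10 / d ^ 2 * (x - d) ^ 2 := by
  have hx0 : 0 < x := by linarith
  obtain ⟨u, hu, rfl⟩ : ∃ u, 0 < u ∧ d = u ^ 2 :=
    ⟨√d, Real.sqrt_pos.2 hd, (Real.sq_sqrt hd.le).symm⟩
  obtain ⟨v, hv, rfl⟩ : ∃ v, 0 < v ∧ x = v ^ 2 :=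
    ⟨√x, Real.sqrt_pos.2 hx0, (Real.sq_sqrt hx0.le).symm⟩
  rw [Real.sqrt_sq hu.le, Real.sqrt_sq hv.le]
  have e : (u / v - 1) ^ 2 = (v - u) ^ 2 / v ^ 2 := by field_simp; ring
  rw [e, div_mul_eq_mul_div, div_le_div_iff₀ (by positivity) (by positivity)]
  have e2 : (v ^ 2 - u ^ 2) ^ 2 = (v - u) ^ 2 * (v + u) ^ 2 := by ring
  rw [e2]
  have h1 : u ^ 2 ≤ (v + u) ^ 2 := by nlinarith [mul_pos hu hv]
  have h2 : u ^ 2 ≤ 10 * v ^ 2 := by linarith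
  calc (v - u) ^ 2 * (u ^ 2) ^ 2 = (v - u) ^ 2 * (u ^ 2 * u ^ 2) := by ring
    _ ≤ (v - u) ^ 2 * ((v + u) ^ 2 * (10 * v ^ 2)) := by gcongr
    _ = _ := by ring

/-- If the adjacency matrix is close to `B` in spectral norm and no degree is too small, then so is
the rescaled normalized adjacency matrix. -/
lemma specNorm_smul_normAdj_sub_le {m : ℕ} {B : Matrix (Fin m) (Fin m) ℝ} {d p C₁ : ℝ}
    (hd : 0 < d) (hpm : p * m = 2 * d) (hC : 0 ≤ C₁) (h0 : ∀ i j, 0 ≤ B i j)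
    (hB : ∀ i j, B i j ≤ p) (hrow : ∀ i, ∑ j, B i j = d) {ω : Fin m → Fin m → Bool}
    (hdeg : ∀ i, d / 10 < deg ω i) (hE : specNorm (adjOf ω - B) ≤ C₁ * √d) :
    specNorm (d • normAdj ω - B) ≤ 49 * C₁ * √d := by
  set g : Fin m → ℝ := fun i => √d / √(deg ω i) with hg
  set G := Matrix.diagonal g with hG
  have hdd : √d ^ 2 = d := Real.sq_sqrt hd.le
  have hg2 : ∀ i, g i ^ 2 ≤ 4 ^ 2 := by
    intro i
    have h1 := hdeg i
    have h2 : 0 < deg ω i := by linarith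
    simp only [hg]
    rw [div_pow, hdd, Real.sq_sqrt h2.le, div_le_iff₀ h2]
    linarith
  have hsum : ∑ i, (g i - 1) ^ 2 ≤ 10 * C₁ ^ 2 * m / d := by
    have h1 : ∑ i, (deg ω i - d) ^ 2 ≤ C₁ ^ 2 * d * m := by
      have h := sum_sq_le_specNorm (adjOf ω - B) (fun _ => 1)
      simp only [mul_one, Matrix.sub_apply, Finset.sum_sub_distrib, hrow, one_pow,
        Finset.sum_const, Finset.card_univ, Fintype.card_fin, nsmul_eq_mul] at h
      refine h.trans ?_
      have := pow_le_pow_left₀ (norm_nonneg _) hE 2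
      rw [mul_pow, hdd] at this
      exact mul_le_mul_of_nonneg_right this (Nat.cast_nonneg _)
    calc _ ≤ ∑ i, 10 / d ^ 2 * (deg ω i - d) ^ 2 :=
          Finset.sum_le_sum fun i _ => sq_sqrt_div_sqrt_sub_one_le hd (hdeg i)
      _ ≤ 10 / d ^ 2 * (C₁ ^ 2 * d * m) := by
          rw [← Finset.mul_sum]; gcongr
      _ = _ := by field_simp
  have hB2 : ∀ i j, B i j ^ 2 ≤ p ^ 2 := fun i j => pow_le_pow_left₀ (h0 i j) (hB i j) 2
  have hp2 : p ^ 2 * m * (10 * C₁ ^ 2 * m / d) = 40 * C₁ ^ 2 * √d ^ 2 := by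
    calc _ = 10 * C₁ ^ 2 * (p * m) ^ 2 / d := by ring
      _ = _ := by rw [hpm, hdd]; field_simp; ring
  have e : d • normAdj ω - B = G * (adjOf ω - B) * G + (G - 1) * B * G + B * (G - 1) := by
    have e1 : d • normAdj ω = G * adjOf ω * G := by
      ext i j
      rw [normAdj, hG, Matrix.smul_apply, Matrix.mul_diagonal, Matrix.diagonal_mul,
        Matrix.mul_diagonal, Matrix.diagonal_mul, smul_eq_mul]
      simp only [hg]
      nth_rewrite 1 [← hdd]
      ring
    rw [e1]; noncomm_ring
  have t1 : specNorm (G * (adjOf ω - B) * G) ≤ 16 * C₁ * √d := by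
    have hGn : specNorm G ≤ 4 := specNorm_diagonal_le (by norm_num) hg2
    have n0 : 0 ≤ specNorm G := norm_nonneg _
    have n1 : 0 ≤ specNorm (adjOf ω - B) := norm_nonneg _
    calc _ ≤ specNorm (G * (adjOf ω - B)) * specNorm G := specNorm_mul_le _ _
      _ ≤ (specNorm G * specNorm (adjOf ω - B)) * specNorm G := by
          gcongr; exact specNorm_mul_le _ _
      _ ≤ 4 * (C₁ * √d) * 4 := by gcongr
      _ = _ := by ring
  have hG1 : G - 1 = Matrix.diagonal fun i => g i - 1 := by
    rw [hG, ← Matrix.diagonal_one, Matrix.diagonal_sub]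
  have t2 : specNorm ((G - 1) * B * G) ≤ 26 * C₁ * √d := by
    refine specNorm_le_of_sum_sq_entries_le (by positivity) ?_
    calc _ ≤ ∑ i, ∑ j : Fin m, (g i - 1) ^ 2 * p ^ 2 * 4 ^ 2 := by
          refine Finset.sum_le_sum fun i _ => Finset.sum_le_sum fun j _ => ?_
          rw [hG1, hG, Matrix.mul_diagonal, Matrix.diagonal_mul, mul_pow, mul_pow]
          have := hB2 i j
          have := hg2 j
          gcongr
      _ = 16 * (p ^ 2 * m * ∑ i, (g i - 1) ^ 2) := by
          simp only [Finset.sum_const, Finset.card_univ, Fintype.card_fin, nsmul_eq_mul,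
            Finset.mul_sum]
          exact Finset.sum_congr rfl fun i _ => by ring
      _ ≤ 16 * (p ^ 2 * m * (10 * C₁ ^ 2 * m / d)) := by gcongr
      _ ≤ _ := by
          rw [hp2]
          have : 0 ≤ C₁ ^ 2 * √d ^ 2 := by positivity
          linarith
  have t3 : specNorm (B * (G - 1)) ≤ 7 * C₁ * √d := by
    refine specNorm_le_of_sum_sq_entries_le (by positivity) ?_
    calc _ ≤ ∑ i : Fin m, ∑ j, p ^ 2 * (g j - 1) ^ 2 := by
          refine Finset.sum_le_sum fun i _ => Finset.sum_le_sum fun j _ => ?_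
          rw [hG1, Matrix.mul_diagonal, mul_pow]
          have := hB2 i j
          gcongr
      _ = p ^ 2 * m * ∑ i, (g i - 1) ^ 2 := by
          simp only [← Finset.mul_sum, Finset.sum_const, Finset.card_univ, Fintype.card_fin,
            nsmul_eq_mul]
          ring
      _ ≤ p ^ 2 * m * (10 * C₁ ^ 2 * m / d) := by gcongr
      _ ≤ _ := by
          rw [hp2]
          have : 0 ≤ C₁ ^ 2 * √d ^ 2 := by positivity
          linarith
  rw [e]
  have := specNorm_add_le (G * (adjOf ω - B) * G + (G - 1) * B * G) (B * (G - 1))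
  have := specNorm_add_le (G * (adjOf ω - B) * G) ((G - 1) * B * G)
  linarith

lemma sum_Bmat_row {n : ℕ} (hn : 0 < n) (a b : ℝ) (i : Fin (2 * n)) :
    ∑ j, Bmat n a b i j = a + b := by
  have hn' : (n : ℝ) ≠ 0 := by positivity
  have h : ∑ j, Bmat n a b i j =
      ∑ j ∈ Finset.range (n + n), if (i.val < n ↔ j < n) then a / n else b / n := by
    rw [← two_mul, ← Fin.sum_univ_eq_sum_range]; rfl
  have h1 : ∀ j ∈ Finset.range n, (if (i.val < n ↔ j < n) then a / n else b / n : ℝ) =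
      if i.val < n then a / n else b / n := fun j hj => by
    simp only [Finset.mem_range.1 hj, iff_true]
  have h2 : ∀ j ∈ Finset.range n, (if (i.val < n ↔ n + j < n) then a / n else b / n : ℝ) =
      if i.val < n then b / n else a / n := fun j _ => by
    simp only [show ¬ n + j < n by omega, iff_false]
    split_ifs <;> rfl
  rw [h, Finset.sum_range_add, Finset.sum_congr rfl h1, Finset.sum_congr rfl h2]
  simp only [Finset.sum_const, Finset.card_range, nsmul_eq_mul]
  split_ifs <;> field_simp
  ring

lemma Bmat_symm (n : ℕ) (a b : ℝ) (i j : Fin (2 * n)) : Bmat n a b i j = Bmat n a b j i := by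
  simp only [Bmat, Matrix.of_apply, iff_comm]

lemma sbm_eq_bernPi (n : ℕ) (a b : ℝ) :
    sbm n (a / n) (b / n) = bernPi fun i j => Bmat n a b i j := rfl

lemma sum_failure_le {x d m : ℝ} (hx : 64 ≤ x) (hd : 5 * Real.log x < d) (hm : m = 2 * x) :
    1 / m + Real.exp (-m) + 2 * m * Real.exp (-(2 * d)) + m * Real.exp (-(d / 2)) ≤
      x ^ (-(1 / 2) : ℝ) := by
  subst hm
  have hx0 : 0 < x := by linarith
  have hlog : 0 ≤ Real.log x := Real.log_nonneg (by linarith)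
  have hexp : Real.exp (-(2 * Real.log x)) = 1 / x ^ 2 := by
    rw [Real.exp_neg, mul_comm, Real.exp_mul, Real.exp_log hx0]; norm_num
  have h1 : 1 / (2 * x) ≤ 1 / x := by gcongr; linarith
  have h2 : Real.exp (-(2 * x)) ≤ 1 / x := by
    rw [Real.exp_neg, ← one_div]
    gcongr
    linarith [Real.add_one_le_exp (2 * x)]
  have h3 : 2 * (2 * x) * Real.exp (-(2 * d)) ≤ 4 / x := by
    calc _ ≤ 2 * (2 * x) * Real.exp (-(2 * Real.log x)) := by gcongr; linarith
      _ = _ := by rw [hexp]; field_simp; norm_num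
  have h4 : 2 * x * Real.exp (-(d / 2)) ≤ 2 / x := by
    calc _ ≤ 2 * x * Real.exp (-(2 * Real.log x)) := by gcongr; linarith
      _ = _ := by rw [hexp]; field_simp
  have h5 : 8 / x ≤ x ^ (-(1 / 2) : ℝ) := by
    rw [Real.rpow_neg hx0.le, ← Real.sqrt_eq_rpow, ← one_div, div_le_div_iff₀ hx0 (by positivity)]
    have : 8 ≤ √x := Real.le_sqrt_of_sq_le (by linarith)
    nlinarith [Real.mul_self_sqrt hx0.le]
  have : 8 / x = 1 / x + 1 / x + 4 / x + 2 / x := by ring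
  linarith

/-- There are constants `C, c > 0` such that for every `ε > 0` and all
sufficiently large `n`: if `a, b ≥ 1` and `d := a + b` satisfies `5·log n < d < n^{1/3-ε}`,
then for `G ∼ G_{2n,a/n,b/n}`, with probability at least `1 - n^{-c}` all degrees are
positive and `‖d·N - B‖ ≤ C·√d`, where `N = D^{-1/2} A D^{-1/2}` and `B = 𝔼[A]`. -/
theorem stmt6 : ∃ C > (0:ℝ), ∃ c > (0:ℝ), ∀ ε > (0:ℝ), ∃ N0 : ℕ, ∀ n : ℕ, N0 ≤ n →
    ∀ a b : ℝ, 1 ≤ a → 1 ≤ b → 5 * Real.log n < a + b →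
      a + b < (n : ℝ) ^ ((1:ℝ)/3 - ε) →
    ENNReal.ofReal (1 - (n : ℝ) ^ (-c)) ≤
      sbm n (a / n) (b / n)
        {ω | (∀ i, 0 < deg ω i) ∧
          specNorm ((a + b) • normAdj ω - Bmat n a b) ≤ C * Real.sqrt (a + b)} := by
  refine ⟨49 * 320268, by norm_num, 1 / 2, by norm_num, fun ε hε => ⟨64, ?_⟩⟩
  intro n hn a b ha hb hlog hup
  set d := a + b with hd
  have hn64 : (64 : ℝ) ≤ n := by exact_mod_cast hn
  have hn0 : (0 : ℝ) < n := by linarith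
  have hd0 : 0 < d := by linarith
  have hD : 0 < √d := Real.sqrt_pos.2 hd0
  have hDd : √d ^ 2 = d := Real.sq_sqrt hd0.le
  have hm : 1 ≤ 2 * n := by omega
  have hdn : d ≤ n := by
    refine hup.le.trans ?_
    calc (n : ℝ) ^ ((1 : ℝ) / 3 - ε) ≤ (n : ℝ) ^ (1 : ℝ) :=
          Real.rpow_le_rpow_of_exponent_le (by linarith) (by linarith)
      _ = n := Real.rpow_one _
  have hp : 0 < d / n := by positivity
  have hpm : d / n * ((2 * n : ℕ) : ℝ) = 2 * d := by push_cast; field_simp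
  have hentry : ∀ i j, 0 ≤ Bmat n a b i j ∧ Bmat n a b i j ≤ d / n := by
    intro i j
    simp only [Bmat, Matrix.of_apply]
    split_ifs
    · exact ⟨by positivity, by gcongr; linarith⟩
    · exact ⟨by positivity, by gcongr; linarith⟩
  have h0 := fun i j => (hentry i j).1
  have hP := fun i j => (hentry i j).2
  have h1 : ∀ i j, Bmat n a b i j ≤ 1 := fun i j =>
    (hP i j).trans ((div_le_one hn0).2 hdn)
  have hrow : ∀ i, ∑ j, Bmat n a b i j = d := sum_Bmat_row (by omega) a b
  have hcol : ∀ j, ∑ i, Bmat n a b i j = d := fun j => by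
    rw [← hrow j]; exact Finset.sum_congr rfl fun i _ => Bmat_symm n a b i j
  rw [sbm_eq_bernPi]
  set P : Fin (2 * n) → Fin (2 * n) → ℝ := fun i j => Bmat n a b i j
  have := bernPi_isProbabilityMeasure (P := P) h0 h1
  set S := {ω | (∀ i, 0 < deg ω i) ∧
    specNorm (d • normAdj ω - Bmat n a b) ≤ 49 * 320268 * √d}
  have hsub : Sᶜ ⊆ {ω | ¬Discrepancy (d / n) ω} ∪ {ω | ¬LightBound P halfMask (√d) ω} ∪
      {ω | ¬RowColBound d ω} ∪ {ω | ¬∀ i, d / 10 < deg ω i} := by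
    intro ω hω
    by_contra hcon
    simp only [Set.mem_union, Set.mem_ofPred_eq, not_or, not_not] at hcon
    obtain ⟨⟨⟨g1, g2⟩, g3⟩, g4⟩ := hcon
    exact hω ⟨fun i => lt_trans (by positivity) (g4 i),
      specNorm_smul_normAdj_sub_le hd0 hpm (by norm_num) h0 hP hrow g4
        (specNorm_adjOf_sub_le hm hp hD hDd hpm h0 hP (Bmat_symm n a b) g3 g1 g2)⟩
  have b1 := bernPi_not_discrepancy (P := P) hm hp h0 h1 hP
  have b2 := bernPi_not_lightBound (P := P) hD (by rw [hDd]; field_simp at hpm ⊢; linarith)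
    h0 h1 hP hp.le halfMask_nonneg halfMask_le_one
  have b3 := bernPi_not_rowColBound (P := P) hd0.le h0 h1 (fun i => (hrow i).le)
    fun j => (hcol j).le
  have b4 := bernPi_deg_lower_tail (P := P) hd0.le h0 h1 (Bmat_symm n a b) hrow
  have hfail : (bernPi P).real Sᶜ ≤ (n : ℝ) ^ (-(1 / 2) : ℝ) := by
    refine le_trans ?_ (sum_failure_le hn64 hlog (m := ((2 * n : ℕ) : ℝ)) (by push_cast; rfl))
    refine (measureReal_mono hsub (measure_ne_top _ _)).trans ?_
    refine (measureReal_union_le _ _).trans (add_le_add ?_ b4)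
    refine (measureReal_union_le _ _).trans (add_le_add ?_ b3)
    exact (measureReal_union_le _ _).trans (add_le_add b1 b2)
  have htot : 1 ≤ (bernPi P).real S + (bernPi P).real Sᶜ := by
    rw [← probReal_univ (μ := bernPi P), ← Set.union_compl_self S]
    exact measureReal_union_le _ _
  rw [ENNReal.ofReal_le_iff_le_toReal (measure_ne_top _ _)]
  change _ ≤ (bernPi P).real S
  linarith
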